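/- arXiv:1706.00216 — 4 statements merged into one kernel-verified Lean document; each statement's English description precedes it below -/
import Mathlib

section
/- Suppose {G^{αβγ}} and {H^{αβ}} satisfy the null condition. Then for each Klainerman vector field Z_i (i = 0,…,10) there exist constants {G̃_i^{αβγ}} satisfying the null condition such that for all smooth functions v, w on (0,∞)×ℝ³: Z_i(G^{αβγ}(∂_γ v)(∂²_{αβ} w)) = G^{αβγ}(∂_γ Z_i v)(∂²_{αβ} w) + G^{αβγ}(∂_γ v)(∂²_{αβ} Z_i w) + G̃_i^{αβγ}(∂_γ v)(∂²_{αβ} w). Similarly there exist constants {H̃_i^{αβ}} satisfying the null condition such that Z_i(H^{αβ}(∂_α v)(∂_β w)) = H^{αβ}(∂_α Z_i v)(∂_β w) + H^{αβ}(∂_α v)(∂_β Z_i w) + H̃_i^{αβ}(∂_α v)(∂_β w). -/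
open MeasureTheory Real Set

noncomputable section

/-- Partial derivative `∂_i` on ℝ⁴ (coordinate `0` is time). -/
def pd (i : Fin 4) (u : (Fin 4 → ℝ) → ℝ) : (Fin 4 → ℝ) → ℝ :=
  fun y => fderiv ℝ u y (Pi.single i 1)

/-- Spatial radius `r = |x|` of a spacetime point. -/
def rad (y : Fin 4 → ℝ) : ℝ := Real.sqrt (∑ i : Fin 3, (y i.succ) ^ 2)

/-- Euclidean length of a space point. -/
def rad3 (x : Fin 3 → ℝ) : ℝ := Real.sqrt (∑ i, (x i) ^ 2)

/-- The 11 Klainerman vector fields `∂_α, Ω_{ij}, L_k, S` (as coefficient vectors). -/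
def KVF (i : Fin 11) (y : Fin 4 → ℝ) : Fin 4 → ℝ :=
  if h : (i : ℕ) < 4 then Pi.single ⟨i, h⟩ 1
  else if (i : ℕ) = 4 then Pi.single 2 (y 1) - Pi.single 1 (y 2)
  else if (i : ℕ) = 5 then Pi.single 3 (y 1) - Pi.single 1 (y 3)
  else if (i : ℕ) = 6 then Pi.single 3 (y 2) - Pi.single 2 (y 3)
  else if (i : ℕ) = 7 then Pi.single 0 (y 1) + Pi.single 1 (y 0)
  else if (i : ℕ) = 8 then Pi.single 0 (y 2) + Pi.single 2 (y 0)
  else if (i : ℕ) = 9 then Pi.single 0 (y 3) + Pi.single 3 (y 0)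
  else y

/-- The Klainerman vector field `Z_i` applied to a function. -/
def Zop (i : Fin 11) (u : (Fin 4 → ℝ) → ℝ) : (Fin 4 → ℝ) → ℝ :=
  fun y => fderiv ℝ u y (KVF i y)

/-- Iterated Klainerman fields `Z^a`. -/
def Zit : List (Fin 11) → ((Fin 4 → ℝ) → ℝ) → (Fin 4 → ℝ) → ℝ
  | [], u => u
  | i :: l, u => Zop i (Zit l u)

/-- All multi-indices `a` with `|a| ≤ m` (as lists of field indices). -/
def idxLists : ℕ → List (List (Fin 11))
  | 0 => [[]]
  | m + 1 => [] :: (idxLists m).flatMap fun l => (List.finRange 11).map fun i => i :: l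

/-- The energy `E₁(u(t))`. -/
def E1 (u : (Fin 4 → ℝ) → ℝ) (t : ℝ) : ℝ :=
  (1 / 2) * ∫ x : Fin 3 → ℝ,
    ((pd 0 u (Fin.cons t x)) ^ 2 + ∑ i : Fin 3, (pd i.succ u (Fin.cons t x)) ^ 2)

/-- The generalized energy seminorm `W_κ(u(t)) = Σ_{|a| ≤ κ-1} E₁^{1/2}(Z^a u(t))`. -/
def Wnorm (κ : ℕ) (u : (Fin 4 → ℝ) → ℝ) (t : ℝ) : ℝ :=
  ((idxLists (κ - 1)).map fun l => Real.sqrt (E1 (Zit l u) t)).sum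

/-- The d'Alembertian `∂_t² - Δ`. -/
def waveOp (u : (Fin 4 → ℝ) → ℝ) (y : Fin 4 → ℝ) : ℝ :=
  pd 0 (pd 0 u) y - ∑ i : Fin 3, pd i.succ (pd i.succ u) y

/-- The quasi-linear null-form `G^{αβγ}(∂_γ v)(∂²_{αβ} w)`. -/
def QG (G : Fin 4 → Fin 4 → Fin 4 → ℝ) (v w : (Fin 4 → ℝ) → ℝ) (y : Fin 4 → ℝ) : ℝ :=
  ∑ α, ∑ β, ∑ γ, G α β γ * pd γ v y * pd α (pd β w) y

/-- The semi-linear form `H^{αβ}(∂_α v)(∂_β w)`. -/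
def QH (H : Fin 4 → Fin 4 → ℝ) (v w : (Fin 4 → ℝ) → ℝ) (y : Fin 4 → ℝ) : ℝ :=
  ∑ α, ∑ β, H α β * pd α v y * pd β w y

/-- Null condition for cubic coefficients. -/
def NullG (G : Fin 4 → Fin 4 → Fin 4 → ℝ) : Prop :=
  ∀ X : Fin 4 → ℝ, (X 0) ^ 2 = (X 1) ^ 2 + (X 2) ^ 2 + (X 3) ^ 2 →
    ∑ α, ∑ β, ∑ γ, G α β γ * X α * X β * X γ = 0

/-- Null condition for quadratic coefficients. -/
def NullH (H : Fin 4 → Fin 4 → ℝ) : Prop :=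
  ∀ X : Fin 4 → ℝ, (X 0) ^ 2 = (X 1) ^ 2 + (X 2) ^ 2 + (X 3) ^ 2 →
    ∑ α, ∑ β, H α β * X α * X β = 0

/-- The good derivative `T_i = ∂_i + (x_i/|x|) ∂_t`. -/
def Tgood (i : Fin 3) (u : (Fin 4 → ℝ) → ℝ) (y : Fin 4 → ℝ) : ℝ :=
  pd i.succ u y + (y i.succ / rad y) * pd 0 u y

/-- The ghost-weight space-time norm `‖⟨t-r⟩^{-1/2-η} T_i w‖_{L²(S×ℝ³)}`. -/
def ghostNorm (η : ℝ) (i : Fin 3) (w : (Fin 4 → ℝ) → ℝ) (S : Set ℝ) : ℝ :=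
  Real.sqrt (∫ t in S, ∫ x : Fin 3 → ℝ,
    (Real.sqrt (1 + (t - rad3 x) ^ 2)) ^ (-(1 : ℝ) - 2 * η) * (Tgood i w (Fin.cons t x)) ^ 2)

/-- `‖w(t,·)‖_{L²(ℝ³)}`. -/
def L2t (w : (Fin 4 → ℝ) → ℝ) (t : ℝ) : ℝ :=
  Real.sqrt (∫ x : Fin 3 → ℝ, (w (Fin.cons t x)) ^ 2)

/-- `‖∂u(t,·)‖_{L²(ℝ³)}`. -/
def DL2 (u : (Fin 4 → ℝ) → ℝ) (t : ℝ) : ℝ :=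
  Real.sqrt (∫ x : Fin 3 → ℝ, ∑ γ : Fin 4, (pd γ u (Fin.cons t x)) ^ 2)

/-- `u` has Cauchy data `(φ₀, φ₁)` at `t = 0`. -/
def HasData (u : (Fin 4 → ℝ) → ℝ) (φ₀ φ₁ : (Fin 3 → ℝ) → ℝ) : Prop :=
  (∀ x, u (Fin.cons 0 x) = φ₀ x) ∧ ∀ x, pd 0 u (Fin.cons 0 x) = φ₁ x


lemma contDiff_pd (u : (Fin 4 → ℝ) → ℝ) (hu : ContDiff ℝ (⊤ : ℕ∞) u) (β : Fin 4) :
    ContDiff ℝ (⊤ : ℕ∞) (pd β u) := by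
  unfold pd
  exact (hu.fderiv_right (m := (⊤ : ℕ∞)) (by simp)).clm_apply contDiff_const

def Kmat (i : Fin 11) (μ ν : Fin 4) : ℝ := KVF i (Pi.single ν 1) μ - KVF i 0 μ

lemma KVF_affine (i : Fin 11) (y : Fin 4 → ℝ) (μ : Fin 4) :
    KVF i y μ = KVF i 0 μ + ∑ ν, Kmat i μ ν * y ν := by
  fin_cases i <;> fin_cases μ <;> simp [KVF, Kmat, Fin.sum_univ_four, Pi.single_apply]

lemma hasFDerivAt_KVF (i : Fin 11) (y : Fin 4 → ℝ) :
    ∃ L : (Fin 4 → ℝ) →L[ℝ] (Fin 4 → ℝ), HasFDerivAt (KVF i) L y ∧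
      ∀ β, L (Pi.single β 1) = fun μ => Kmat i μ β := by
  refine ⟨ContinuousLinearMap.pi fun μ => ∑ ν, Kmat i μ ν •
    ContinuousLinearMap.proj (R := ℝ) (φ := fun _ : Fin 4 => ℝ) ν, ?_, ?_⟩
  · rw [hasFDerivAt_pi]
    intro μ
    have : (fun y => KVF i y μ) = fun y => KVF i 0 μ + ∑ ν, Kmat i μ ν * y ν := by
      funext y; exact KVF_affine i y μ
    rw [this]
    refine HasFDerivAt.const_add _ ?_
    refine HasFDerivAt.fun_sum fun ν _ => ?_
    exact (hasFDerivAt_apply ν y).const_mul _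
  · intro β
    funext μ
    simp [Pi.single_apply]

lemma fderiv_eq_sum (u : (Fin 4 → ℝ) → ℝ) (y a : Fin 4 → ℝ) :
    fderiv ℝ u y a = ∑ μ, a μ * pd μ u y := by
  conv_lhs => rw [← Finset.univ_sum_single a]
  rw [map_sum]
  refine Finset.sum_congr rfl fun μ _ => ?_
  have : (Pi.single μ (a μ) : Fin 4 → ℝ) = a μ • Pi.single μ 1 := by
    rw [← Pi.single_smul]; simp
  rw [this, map_smul]; rfl

lemma contDiff_Zop (i : Fin 11) (u : (Fin 4 → ℝ) → ℝ) (hu : ContDiff ℝ (⊤ : ℕ∞) u) :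
    ContDiff ℝ (⊤ : ℕ∞) (Zop i u) := by
  unfold Zop
  refine (hu.fderiv_right (m := (⊤ : ℕ∞)) (by simp)).clm_apply ?_
  rw [contDiff_pi]
  intro μ
  have : (fun y => KVF i y μ) = fun y => KVF i 0 μ + ∑ ν, Kmat i μ ν * y ν := by
    funext y; exact KVF_affine i y μ
  rw [this]
  fun_prop

lemma pd_Zop (i : Fin 11) (u : (Fin 4 → ℝ) → ℝ) (hu : ContDiff ℝ (⊤ : ℕ∞) u) (β : Fin 4)
    (y : Fin 4 → ℝ) :
    pd β (Zop i u) y = Zop i (pd β u) y + ∑ μ, Kmat i μ β * pd μ u y := by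
  obtain ⟨L, hL, hLβ⟩ := hasFDerivAt_KVF i y
  have hd : DifferentiableAt ℝ (fderiv ℝ u) y :=
    ((hu.fderiv_right (m := (⊤ : ℕ∞)) (by simp)).differentiable (by simp)) y
  have h1 := (hd.hasFDerivAt.clm_apply hL).fderiv
  have h2 := (hd.hasFDerivAt.clm_apply (hasFDerivAt_const (Pi.single β (1 : ℝ) : Fin 4 → ℝ) y)).fderiv
  have hs : IsSymmSndFDerivAt ℝ u y :=
    (hu.contDiffAt).isSymmSndFDerivAt (by
      simp only [minSmoothness_of_isRCLikeNormedField]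
      exact WithTop.coe_le_coe.2 (le_top : (2 : ℕ∞) ≤ ⊤))
  have h3 : pd β (Zop i u) y = fderiv ℝ u y (L (Pi.single β 1))
      + fderiv ℝ (fderiv ℝ u) y (Pi.single β 1) (KVF i y) := by
    unfold pd Zop
    rw [h1]; simp
  have h4 : Zop i (pd β u) y = fderiv ℝ (fderiv ℝ u) y (KVF i y) (Pi.single β 1) := by
    unfold pd Zop
    rw [h2]; simp
  rw [h3, h4, hs.eq, hLβ, fderiv_eq_sum]
  ring

lemma pd_add_sum (α : Fin 4) (f : (Fin 4 → ℝ) → ℝ) (g : Fin 4 → (Fin 4 → ℝ) → ℝ)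
    (c : Fin 4 → ℝ) (hf : Differentiable ℝ f) (hg : ∀ μ, Differentiable ℝ (g μ))
    (y : Fin 4 → ℝ) :
    pd α (fun y => f y + ∑ μ, c μ * g μ y) y = pd α f y + ∑ μ, c μ * pd α (g μ) y := by
  have h := ((hf y).hasFDerivAt.add (HasFDerivAt.fun_sum (u := Finset.univ)
    fun μ _ => ((hg μ) y).hasFDerivAt.const_mul (c μ))).fderiv
  have h' := congrArg (fun T => T (Pi.single α (1 : ℝ))) h
  simp only [_root_.add_apply, _root_.sum_apply,
    _root_.smul_apply, smul_eq_mul] at h'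
  exact h'

lemma pd_pd_Zop (i : Fin 11) (u : (Fin 4 → ℝ) → ℝ) (hu : ContDiff ℝ (⊤ : ℕ∞) u) (α β : Fin 4)
    (y : Fin 4 → ℝ) :
    pd α (pd β (Zop i u)) y = Zop i (pd α (pd β u)) y + ∑ μ, Kmat i μ α * pd μ (pd β u) y
      + ∑ μ, Kmat i μ β * pd α (pd μ u) y := by
  have h : pd β (Zop i u) = fun y => Zop i (pd β u) y + ∑ μ, Kmat i μ β * pd μ u y :=
    funext fun y => pd_Zop i u hu β y
  rw [h, pd_add_sum, pd_Zop i _ (contDiff_pd u hu β)]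
  · exact (contDiff_Zop i _ (contDiff_pd u hu β)).differentiable (by simp)
  · exact fun μ => (contDiff_pd u hu μ).differentiable (by simp)

lemma Zop_mul3 (i : Fin 11) (c : ℝ) (f g : (Fin 4 → ℝ) → ℝ)
    (hf : Differentiable ℝ f) (hg : Differentiable ℝ g) (y : Fin 4 → ℝ) :
    Zop i (fun z => c * f z * g z) y = c * (Zop i f y * g y + f y * Zop i g y) := by
  unfold Zop
  rw [(((hf y).hasFDerivAt.const_mul c).fun_mul (hg y).hasFDerivAt).fderiv]
  simp
  ring

lemma Zop_sum (i : Fin 11) (f : Fin 4 → (Fin 4 → ℝ) → ℝ)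
    (hf : ∀ μ, Differentiable ℝ (f μ)) (y : Fin 4 → ℝ) :
    Zop i (fun z => ∑ μ, f μ z) y = ∑ μ, Zop i (f μ) y := by
  unfold Zop
  rw [(HasFDerivAt.fun_sum (u := Finset.univ) fun μ _ => ((hf μ) y).hasFDerivAt).fderiv]
  simp

def Gnew (A : Fin 4 → Fin 4 → ℝ) (G : Fin 4 → Fin 4 → Fin 4 → ℝ) (α β γ : Fin 4) : ℝ :=
  -((∑ μ, G α β μ * A γ μ) + (∑ μ, G α μ γ * A β μ) + ∑ μ, G μ β γ * A α μ)

def Hnew (A : Fin 4 → Fin 4 → ℝ) (H : Fin 4 → Fin 4 → ℝ) (α β : Fin 4) : ℝ :=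
  -((∑ μ, H α μ * A β μ) + ∑ μ, H μ β * A α μ)

lemma swap1 (f : Fin 4 → ℝ) (g : Fin 4 → Fin 4 → ℝ) (t : Fin 4 → ℝ) :
    ∑ γ, (∑ μ, f μ * g γ μ) * t γ = ∑ γ, f γ * ∑ μ, g μ γ * t μ := by
  simp only [Finset.sum_mul, Finset.mul_sum]
  rw [Finset.sum_comm]
  simp only [mul_assoc]

lemma Hnew_sum (A : Fin 4 → Fin 4 → ℝ) (H : Fin 4 → Fin 4 → ℝ) (T : Fin 4 → Fin 4 → ℝ) :
    ∑ α, ∑ β, Hnew A H α β * T α β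
      = -∑ α, ∑ β, H α β * ((∑ μ, A μ β * T α μ) + ∑ μ, A μ α * T μ β) := by
  simp only [Hnew, neg_mul, add_mul, mul_add, Finset.sum_neg_distrib, Finset.sum_add_distrib]
  congr 2
  · exact Finset.sum_congr rfl fun α _ => swap1 _ _ _
  · rw [Finset.sum_comm]
    conv_rhs => rw [Finset.sum_comm]
    exact Finset.sum_congr rfl fun β _ => swap1 (fun μ => H μ β) A (fun α => T α β)

lemma Gnew_sum (A : Fin 4 → Fin 4 → ℝ) (G : Fin 4 → Fin 4 → Fin 4 → ℝ)
    (T : Fin 4 → Fin 4 → Fin 4 → ℝ) :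
    ∑ α, ∑ β, ∑ γ, Gnew A G α β γ * T α β γ
      = -∑ α, ∑ β, ∑ γ, G α β γ * ((∑ μ, A μ γ * T α β μ) + (∑ μ, A μ β * T α μ γ)
          + ∑ μ, A μ α * T μ β γ) := by
  simp only [Gnew, neg_mul, add_mul, mul_add, Finset.sum_neg_distrib, Finset.sum_add_distrib]
  congr 2
  · congr 1
    · exact Finset.sum_congr rfl fun α _ => Finset.sum_congr rfl fun β _ => swap1 _ _ _
    · refine Finset.sum_congr rfl fun α _ => ?_
      rw [Finset.sum_comm]
      conv_rhs => rw [Finset.sum_comm]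
      exact Finset.sum_congr rfl fun γ _ => swap1 (fun μ => G α μ γ) A (fun β => T α β γ)
  · rw [Finset.sum_comm]
    conv_rhs => rw [Finset.sum_comm]
    refine Finset.sum_congr rfl fun β _ => ?_
    rw [Finset.sum_comm]
    conv_rhs => rw [Finset.sum_comm]
    exact Finset.sum_congr rfl fun γ _ => swap1 (fun μ => G μ β γ) A (fun α => T α β γ)

lemma rot_deriv (a b : ℝ) : HasDerivAt (fun s => a * cos s + b * sin s) b 0 := by
  have := ((hasDerivAt_cos 0).const_mul a).fun_add ((hasDerivAt_sin 0).const_mul b)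
  simpa using this

lemma boost_deriv (a b : ℝ) : HasDerivAt (fun s => a * cosh s + b * sinh s) b 0 := by
  have := ((hasDerivAt_cosh 0).const_mul a).fun_add ((hasDerivAt_sinh 0).const_mul b)
  simpa using this

lemma scale_deriv (a : ℝ) : HasDerivAt (fun s : ℝ => a + a * s) a 0 := by
  have := ((hasDerivAt_id (0 : ℝ)).const_mul a).const_add a
  simpa using this

lemma cone_curve (i : Fin 11) (X : Fin 4 → ℝ)
    (hX : (X 0) ^ 2 = (X 1) ^ 2 + (X 2) ^ 2 + (X 3) ^ 2) :
    ∃ φ : ℝ → Fin 4 → ℝ, φ 0 = X ∧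
      (∀ s, (φ s 0) ^ 2 = (φ s 1) ^ 2 + (φ s 2) ^ 2 + (φ s 3) ^ 2) ∧
      ∀ ν, HasDerivAt (fun s => φ s ν) (∑ μ, Kmat i μ ν * X μ) 0 := by
  have htriv : (∀ μ ν, Kmat i μ ν = 0) → ∃ φ : ℝ → Fin 4 → ℝ, φ 0 = X ∧
      (∀ s, (φ s 0) ^ 2 = (φ s 1) ^ 2 + (φ s 2) ^ 2 + (φ s 3) ^ 2) ∧
      ∀ ν, HasDerivAt (fun s => φ s ν) (∑ μ, Kmat i μ ν * X μ) 0 := by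
    intro h
    refine ⟨fun _ => X, rfl, fun _ => hX, fun ν => ?_⟩
    simpa [h] using hasDerivAt_const (0 : ℝ) (X ν)
  have hc := fun s : ℝ => cos_sq_add_sin_sq s
  have hh := fun s : ℝ => cosh_sq_sub_sinh_sq s
  fin_cases i
  iterate 4 exact htriv (fun μ ν => by simp [Kmat, KVF])
  · refine ⟨fun s => ![X 0, X 1 * cos s + X 2 * sin s, X 2 * cos s + (-X 1) * sin s, X 3],
      ?_, ?_, ?_⟩
    · funext ν; fin_cases ν <;> simp
    · intro s; simp; linear_combination hX - (X 1 ^ 2 + X 2 ^ 2) * hc s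
    · intro ν
      fin_cases ν <;> simp [Kmat, KVF, Fin.sum_univ_four, Pi.single_apply, hasDerivAt_const]
      · exact rot_deriv _ _
      · simpa using rot_deriv (X 2) (-X 1)
  · refine ⟨fun s => ![X 0, X 1 * cos s + X 3 * sin s, X 2, X 3 * cos s + (-X 1) * sin s],
      ?_, ?_, ?_⟩
    · funext ν; fin_cases ν <;> simp
    · intro s; simp; linear_combination hX - (X 1 ^ 2 + X 3 ^ 2) * hc s
    · intro ν
      fin_cases ν <;> simp [Kmat, KVF, Fin.sum_univ_four, Pi.single_apply, hasDerivAt_const]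
      · exact rot_deriv _ _
      · simpa using rot_deriv (X 3) (-X 1)
  · refine ⟨fun s => ![X 0, X 1, X 2 * cos s + X 3 * sin s, X 3 * cos s + (-X 2) * sin s],
      ?_, ?_, ?_⟩
    · funext ν; fin_cases ν <;> simp
    · intro s; simp; linear_combination hX - (X 2 ^ 2 + X 3 ^ 2) * hc s
    · intro ν
      fin_cases ν <;> simp [Kmat, KVF, Fin.sum_univ_four, Pi.single_apply, hasDerivAt_const]
      · exact rot_deriv _ _
      · simpa using rot_deriv (X 3) (-X 2)
  · refine ⟨fun s => ![X 0 * cosh s + X 1 * sinh s, X 1 * cosh s + X 0 * sinh s, X 2, X 3],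
      ?_, ?_, ?_⟩
    · funext ν; fin_cases ν <;> simp
    · intro s; simp; linear_combination hX + (X 0 ^ 2 - X 1 ^ 2) * hh s
    · intro ν
      fin_cases ν <;> simp [Kmat, KVF, Fin.sum_univ_four, Pi.single_apply, hasDerivAt_const]
      · exact boost_deriv _ _
      · exact boost_deriv _ _
  · refine ⟨fun s => ![X 0 * cosh s + X 2 * sinh s, X 1, X 2 * cosh s + X 0 * sinh s, X 3],
      ?_, ?_, ?_⟩
    · funext ν; fin_cases ν <;> simp
    · intro s; simp; linear_combination hX + (X 0 ^ 2 - X 2 ^ 2) * hh s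
    · intro ν
      fin_cases ν <;> simp [Kmat, KVF, Fin.sum_univ_four, Pi.single_apply, hasDerivAt_const]
      · exact boost_deriv _ _
      · exact boost_deriv _ _
  · refine ⟨fun s => ![X 0 * cosh s + X 3 * sinh s, X 1, X 2, X 3 * cosh s + X 0 * sinh s],
      ?_, ?_, ?_⟩
    · funext ν; fin_cases ν <;> simp
    · intro s; simp; linear_combination hX + (X 0 ^ 2 - X 3 ^ 2) * hh s
    · intro ν
      fin_cases ν <;> simp [Kmat, KVF, Fin.sum_univ_four, Pi.single_apply, hasDerivAt_const]
      · exact boost_deriv _ _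
      · exact boost_deriv _ _
  · refine ⟨fun s ν => X ν + X ν * s, ?_, ?_, ?_⟩
    · funext ν; simp
    · intro s; linear_combination (1 + s) ^ 2 * hX
    · intro ν
      have : ∑ μ, Kmat 10 μ ν * X μ = X ν := by
        fin_cases ν <;> simp [Kmat, KVF, Fin.sum_univ_four]
      exact (scale_deriv (X ν)).congr_deriv this.symm

lemma nullG_new (i : Fin 11) (G : Fin 4 → Fin 4 → Fin 4 → ℝ) (hG : NullG G) :
    NullG (Gnew (Kmat i) G) := by
  intro X hX
  obtain ⟨φ, h0, hc, hd⟩ := cone_curve i X hX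
  have h1 : HasDerivAt (fun s => ∑ α, ∑ β, ∑ γ, G α β γ * φ s α * φ s β * φ s γ) _ 0 :=
    HasDerivAt.fun_sum fun α _ => HasDerivAt.fun_sum fun β _ => HasDerivAt.fun_sum fun γ _ =>
      (((hd α).const_mul (G α β γ)).fun_mul (hd β)).fun_mul (hd γ)
  have h2 : (fun s => ∑ α, ∑ β, ∑ γ, G α β γ * φ s α * φ s β * φ s γ) = fun _ => 0 :=
    funext fun s => hG (φ s) (hc s)
  rw [h2] at h1
  have h3 := h1.unique (hasDerivAt_const 0 0)
  have h4 := Gnew_sum (Kmat i) G (fun α β γ => X α * X β * X γ)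
  simp only [← mul_assoc] at h4
  rw [h4, neg_eq_zero, ← h3, h0]
  refine Finset.sum_congr rfl fun α _ => Finset.sum_congr rfl fun β _ =>
    Finset.sum_congr rfl fun γ _ => ?_
  simp only [Fin.sum_univ_four]
  ring

lemma nullH_new (i : Fin 11) (H : Fin 4 → Fin 4 → ℝ) (hH : NullH H) :
    NullH (Hnew (Kmat i) H) := by
  intro X hX
  obtain ⟨φ, h0, hc, hd⟩ := cone_curve i X hX
  have h1 : HasDerivAt (fun s => ∑ α, ∑ β, H α β * φ s α * φ s β) _ 0 :=
    HasDerivAt.fun_sum fun α _ => HasDerivAt.fun_sum fun β _ =>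
      ((hd α).const_mul (H α β)).fun_mul (hd β)
  have h2 : (fun s => ∑ α, ∑ β, H α β * φ s α * φ s β) = fun _ => 0 :=
    funext fun s => hH (φ s) (hc s)
  rw [h2] at h1
  have h3 := h1.unique (hasDerivAt_const 0 0)
  have h4 := Hnew_sum (Kmat i) H (fun α β => X α * X β)
  simp only [← mul_assoc] at h4
  rw [h4, neg_eq_zero, ← h3, h0]
  refine Finset.sum_congr rfl fun α _ => Finset.sum_congr rfl fun β _ => ?_
  simp only [Fin.sum_univ_four]
  ring

/-- **Lemma 2.1.** The null form is preserved under differentiation by the Klainerman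
vector fields: applying `Z_i` to `G^{αβγ}(∂_γ v)(∂²_{αβ} w)` (resp.
`H^{αβ}(∂_α v)(∂_β w)`) produces the same null forms of `Z_i v, w` and `v, Z_i w` plus a
null form with new coefficients again satisfying the null condition. -/
theorem stmt4_null_form_commutation
    (G : Fin 4 → Fin 4 → Fin 4 → ℝ) (H : Fin 4 → Fin 4 → ℝ)
    (hnG : NullG G) (hnH : NullH H) (i : Fin 11) :
    ∃ G' : Fin 4 → Fin 4 → Fin 4 → ℝ, NullG G' ∧
    ∃ H' : Fin 4 → Fin 4 → ℝ, NullH H' ∧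
      ∀ v w : (Fin 4 → ℝ) → ℝ, ContDiff ℝ (⊤ : ℕ∞) v → ContDiff ℝ (⊤ : ℕ∞) w →
        ∀ y : Fin 4 → ℝ, 0 < y 0 →
          Zop i (fun z => QG G v w z) y
            = QG G (Zop i v) w y + QG G v (Zop i w) y + QG G' v w y ∧
          Zop i (fun z => QH H v w z) y
            = QH H (Zop i v) w y + QH H v (Zop i w) y + QH H' v w y := by
  refine ⟨Gnew (Kmat i) G, nullG_new i G hnG, Hnew (Kmat i) H, nullH_new i H hnH, ?_⟩
  intro v w hv hw y _
  have dv : ∀ μ, Differentiable ℝ (pd μ v) := fun μ =>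
    (contDiff_pd v hv μ).differentiable (by simp)
  have dw : ∀ μ, Differentiable ℝ (pd μ w) := fun μ =>
    (contDiff_pd w hw μ).differentiable (by simp)
  have ddw : ∀ ν μ, Differentiable ℝ (pd ν (pd μ w)) := fun ν μ =>
    (contDiff_pd _ (contDiff_pd w hw μ) ν).differentiable (by simp)
  constructor
  · have h1 : Zop i (fun z => QG G v w z) y = ∑ α, ∑ β, ∑ γ, G α β γ *
        (Zop i (pd γ v) y * pd α (pd β w) y + pd γ v y * Zop i (pd α (pd β w)) y) := by
      unfold QG
      rw [Zop_sum i _ (by fun_prop)]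
      refine Finset.sum_congr rfl fun α _ => ?_
      rw [Zop_sum i _ (by fun_prop)]
      refine Finset.sum_congr rfl fun β _ => ?_
      rw [Zop_sum i _ (by fun_prop)]
      exact Finset.sum_congr rfl fun γ _ => Zop_mul3 i _ _ _ (dv γ) (ddw α β) y
    have h2 := Gnew_sum (Kmat i) G (fun α β γ => pd γ v y * pd α (pd β w) y)
    simp only [← mul_assoc] at h2
    rw [h1]
    simp only [QG]
    rw [h2, ← sub_eq_add_neg, eq_sub_iff_add_eq]
    simp only [← Finset.sum_add_distrib]
    refine Finset.sum_congr rfl fun α _ => Finset.sum_congr rfl fun β _ =>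
      Finset.sum_congr rfl fun γ _ => ?_
    rw [pd_Zop i v hv, pd_pd_Zop i w hw]
    simp only [Fin.sum_univ_four]
    ring
  · have h1 : Zop i (fun z => QH H v w z) y = ∑ α, ∑ β, H α β *
        (Zop i (pd α v) y * pd β w y + pd α v y * Zop i (pd β w) y) := by
      unfold QH
      rw [Zop_sum i _ (by fun_prop)]
      refine Finset.sum_congr rfl fun α _ => ?_
      rw [Zop_sum i _ (by fun_prop)]
      exact Finset.sum_congr rfl fun β _ => Zop_mul3 i _ _ _ (dv α) (dw β) y
    have h2 := Hnew_sum (Kmat i) H (fun α β => pd α v y * pd β w y)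
    simp only [← mul_assoc] at h2
    rw [h1]
    simp only [QH]
    rw [h2, ← sub_eq_add_neg, eq_sub_iff_add_eq]
    simp only [← Finset.sum_add_distrib]
    refine Finset.sum_congr rfl fun α _ => Finset.sum_congr rfl fun β _ => ?_
    rw [pd_Zop i v hv, pd_Zop i w hw]
    simp only [Fin.sum_univ_four]
    ring
end
end

section
/- Suppose {G^{αβγ}} and {H^{αβ}} satisfy the null condition. Then there exists a constant C > 0, depending only on the coefficients, such that for all smooth functions v, w on (0,∞)×ℝ³ and all (t,x) with x ≠ 0: |G^{αβγ}(∂_γ v)(∂²_{αβ} w)| ≤ C(|Tv||∂²w| + |∂v||T∂w|) and |H^{αβ}(∂_α v)(∂_β w)| ≤ C(|Tv||∂w| + |∂v||Tw|). -/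
open MeasureTheory Real Set

noncomputable section

/-- `|Tv| = (Σ_{i=1}^3 |T_i v|²)^{1/2}`. -/
def normT (v : (Fin 4 → ℝ) → ℝ) (y : Fin 4 → ℝ) : ℝ :=
  Real.sqrt (∑ i : Fin 3, (Tgood i v y) ^ 2)

/-- `|∂v| = (Σ_{γ=0}^3 |∂_γ v|²)^{1/2}`. -/
def normD (v : (Fin 4 → ℝ) → ℝ) (y : Fin 4 → ℝ) : ℝ :=
  Real.sqrt (∑ γ : Fin 4, (pd γ v y) ^ 2)

/-- `|T∂v| = (Σ_{i=1}^3 Σ_{γ=0}^3 |T_i ∂_γ v|²)^{1/2}`. -/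
def normTD (v : (Fin 4 → ℝ) → ℝ) (y : Fin 4 → ℝ) : ℝ :=
  Real.sqrt (∑ i : Fin 3, ∑ γ : Fin 4, (Tgood i (pd γ v) y) ^ 2)

/-- `|∂²v| = (Σ_{α,β=0}^3 |∂²_{αβ} v|²)^{1/2}`. -/
def normD2 (v : (Fin 4 → ℝ) → ℝ) (y : Fin 4 → ℝ) : ℝ :=
  Real.sqrt (∑ α : Fin 4, ∑ β : Fin 4, (pd α (pd β v) y) ^ 2)

def Xv (y : Fin 4 → ℝ) : Fin 4 → ℝ := Fin.cons (-1) (fun i : Fin 3 => y i.succ / rad y)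

def Av (u : (Fin 4 → ℝ) → ℝ) (y : Fin 4 → ℝ) : Fin 4 → ℝ := Fin.cons 0 (fun i : Fin 3 => Tgood i u y)

lemma Av_eq (u : (Fin 4 → ℝ) → ℝ) (y : Fin 4 → ℝ) (α : Fin 4) :
    pd α u y = Av u y α - Xv y α * pd 0 u y := by
  refine Fin.cases ?_ (fun i => ?_) α
  · simp [Av, Xv]
  · simp [Av, Xv, Tgood]

lemma rad_pos (y : Fin 4 → ℝ) (h : (fun i : Fin 3 => y i.succ) ≠ 0) : 0 < rad y := by
  apply Real.sqrt_pos.2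
  obtain ⟨i, hi⟩ := Function.ne_iff.1 h
  exact Finset.sum_pos' (fun j _ => sq_nonneg _) ⟨i, Finset.mem_univ _, by
    have : y i.succ ≠ 0 := hi
    positivity⟩

lemma Xv_null (y : Fin 4 → ℝ) (h : (fun i : Fin 3 => y i.succ) ≠ 0) :
    (Xv y 0) ^ 2 = (Xv y 1) ^ 2 + (Xv y 2) ^ 2 + (Xv y 3) ^ 2 := by
  have hr := rad_pos y h
  have h2 : rad y ^ 2 = y 1 ^ 2 + y 2 ^ 2 + y 3 ^ 2 := by
    unfold rad
    rw [Real.sq_sqrt (by positivity), Fin.sum_univ_three]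
    rfl
  have e0 : Xv y 0 = -1 := rfl
  have e1 : Xv y 1 = y 1 / rad y := rfl
  have e2 : Xv y 2 = y 2 / rad y := rfl
  have e3 : Xv y 3 = y 3 / rad y := rfl
  rw [e0, e1, e2, e3]
  field_simp
  linarith

lemma Xv_le (y : Fin 4 → ℝ) (h : (fun i : Fin 3 => y i.succ) ≠ 0) (α : Fin 4) :
    |Xv y α| ≤ 1 := by
  have hn := Xv_null y h
  have e0 : Xv y 0 = -1 := rfl
  rw [e0] at hn
  rw [← sq_le_one_iff_abs_le_one]
  fin_cases α
  · simp [e0]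
  all_goals
    simp only [Fin.reduceFinMk, Fin.mk_one]
    nlinarith [sq_nonneg (Xv y 1), sq_nonneg (Xv y 2), sq_nonneg (Xv y 3)]

lemma Av_le (u : (Fin 4 → ℝ) → ℝ) (y : Fin 4 → ℝ) (α : Fin 4) : |Av u y α| ≤ normT u y := by
  refine Fin.cases ?_ (fun i => ?_) α
  · simp [Av, normT]
  · apply Real.abs_le_sqrt
    simp only [Av, Fin.cons_succ]
    exact Finset.single_le_sum (f := fun i : Fin 3 => (Tgood i u y) ^ 2)
      (fun j _ => sq_nonneg _) (Finset.mem_univ i)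

lemma pd_le (u : (Fin 4 → ℝ) → ℝ) (y : Fin 4 → ℝ) (α : Fin 4) : |pd α u y| ≤ normD u y :=
  Real.abs_le_sqrt (Finset.single_le_sum (f := fun i : Fin 4 => (pd i u y) ^ 2)
      (fun j _ => sq_nonneg _) (Finset.mem_univ α))

lemma pd2_le (u : (Fin 4 → ℝ) → ℝ) (y : Fin 4 → ℝ) (α β : Fin 4) :
    |pd α (pd β u) y| ≤ normD2 u y := by
  apply Real.abs_le_sqrt
  refine le_trans ?_ (Finset.single_le_sum (f := fun i : Fin 4 => ∑ β : Fin 4, (pd i (pd β u) y) ^ 2)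
      (fun j _ => Finset.sum_nonneg fun _ _ => sq_nonneg _) (Finset.mem_univ α))
  exact Finset.single_le_sum (f := fun b : Fin 4 => (pd α (pd b u) y) ^ 2)
      (fun j _ => sq_nonneg _) (Finset.mem_univ β)

lemma Av2_le (u : (Fin 4 → ℝ) → ℝ) (y : Fin 4 → ℝ) (α β : Fin 4) :
    |Av (pd β u) y α| ≤ normTD u y := by
  refine (Av_le _ _ _).trans (Real.sqrt_le_sqrt (Finset.sum_le_sum fun i _ => ?_))
  exact Finset.single_le_sum (f := fun b : Fin 4 => (Tgood i (pd b u) y) ^ 2)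
      (fun j _ => sq_nonneg _) (Finset.mem_univ β)

lemma pd_comm (w : (Fin 4 → ℝ) → ℝ) (hw : ContDiff ℝ (⊤ : ℕ∞) w) (y : Fin 4 → ℝ) (α β : Fin 4) :
    pd α (pd β w) y = pd β (pd α w) y := by
  have hw2 : ContDiff ℝ 2 w := contDiff_infty.1 hw 2
  have hd : DifferentiableAt ℝ (fderiv ℝ w) y :=
    ((hw2.fderiv_right (m := 1) (by norm_num)).differentiable (by norm_num)) y
  have key : ∀ a b : Fin 4, pd a (pd b w) y
      = fderiv ℝ (fderiv ℝ w) y (Pi.single a 1) (Pi.single b 1) := by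
    intro a b
    unfold pd
    rw [fderiv_clm_apply hd (differentiableAt_const _)]
    simp
  rw [key, key]
  exact (hw2.contDiffAt.isSymmSndFDerivAt (by simp)) _ _

/-- **Lemma 2.2.** If `G` and `H` satisfy the null condition, then pointwise (for `x ≠ 0`)
`|G^{αβγ}(∂_γ v)(∂²_{αβ} w)| ≤ C(|Tv||∂²w| + |∂v||T∂w|)` and
`|H^{αβ}(∂_α v)(∂_β w)| ≤ C(|Tv||∂w| + |∂v||Tw|)`. -/
theorem stmt5_null_form_pointwise_estimate
    (G : Fin 4 → Fin 4 → Fin 4 → ℝ) (H : Fin 4 → Fin 4 → ℝ)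
    (hnG : NullG G) (hnH : NullH H) :
    ∃ C > (0 : ℝ),
      ∀ v w : (Fin 4 → ℝ) → ℝ, ContDiff ℝ (⊤ : ℕ∞) v → ContDiff ℝ (⊤ : ℕ∞) w →
        ∀ y : Fin 4 → ℝ, 0 < y 0 → (fun i : Fin 3 => y i.succ) ≠ 0 →
          |QG G v w y| ≤ C * (normT v y * normD2 w y + normD v y * normTD w y) ∧
          |QH H v w y| ≤ C * (normT v y * normD w y + normD v y * normT w y) := by
  classical
  set CG := ∑ α, ∑ β, ∑ γ, |G α β γ| with hCG
  set CH := ∑ α, ∑ β, |H α β| with hCH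
  have hG0 : 0 ≤ CG := by positivity
  have hH0 : 0 ≤ CH := by positivity
  refine ⟨2 * CG + CH + 1, by positivity, fun v w _ hw y _ hy => ?_⟩
  have t0 : 0 ≤ normT v y := Real.sqrt_nonneg _
  have t1 : 0 ≤ normT w y := Real.sqrt_nonneg _
  have t2 : 0 ≤ normD v y := Real.sqrt_nonneg _
  have t3 : 0 ≤ normD w y := Real.sqrt_nonneg _
  have t4 : 0 ≤ normD2 w y := Real.sqrt_nonneg _
  have t5 : 0 ≤ normTD w y := Real.sqrt_nonneg _
  have hX := Xv_le y hy
  have m2 : ∀ {a b p q : ℝ}, |a| ≤ p → |b| ≤ q → |a * b| ≤ p * q := by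
    intro a b p q h1 h2
    rw [abs_mul]
    exact mul_le_mul h1 h2 (abs_nonneg _) ((abs_nonneg _).trans h1)
  constructor
  · have e : QG G v w y = ∑ α, ∑ β, ∑ γ, G α β γ * (Av v y γ * pd α (pd β w) y
        - pd 0 v y * (Xv y γ * Av (pd β w) y α)
        + pd 0 v y * (Xv y γ * (Xv y α * Av (pd 0 w) y β))) := by
      have h0 := hnG (Xv y) (Xv_null y hy)
      have : QG G v w y = QG G v w y + (pd 0 v y * pd 0 (pd 0 w) y) *
        ∑ α, ∑ β, ∑ γ, G α β γ * Xv y α * Xv y β * Xv y γ := by rw [h0]; ring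
      rw [this]
      unfold QG
      simp only [Finset.mul_sum, ← Finset.sum_add_distrib]
      refine Finset.sum_congr rfl fun α _ => Finset.sum_congr rfl fun β _ =>
        Finset.sum_congr rfl fun γ _ => ?_
      have a1 := Av_eq v y γ
      have a2 := Av_eq (pd β w) y α
      have a3 := Av_eq (pd 0 w) y β
      rw [pd_comm w hw y β 0] at a3
      rw [a3] at a2
      generalize pd α (pd β w) y = m at *
      subst a2
      rw [a1]
      ring
    have b : |QG G v w y| ≤ CG * (normT v y * normD2 w y + 2 * (normD v y * normTD w y)) := by
      rw [e, hCG]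
      simp only [Finset.sum_mul]
      refine (Finset.abs_sum_le_sum_abs _ _).trans (Finset.sum_le_sum fun α _ => ?_)
      refine (Finset.abs_sum_le_sum_abs _ _).trans (Finset.sum_le_sum fun β _ => ?_)
      refine (Finset.abs_sum_le_sum_abs _ _).trans (Finset.sum_le_sum fun γ _ => ?_)
      refine m2 le_rfl ?_
      have b1 := m2 (Av_le v y γ) (pd2_le w y α β)
      have b2 := m2 (pd_le v y 0) (m2 (hX γ) (Av2_le w y α β))
      have b3 := m2 (pd_le v y 0) (m2 (hX γ) (m2 (hX α) (Av2_le w y β 0)))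
      rw [abs_le] at *
      constructor <;> linarith
    refine b.trans ?_
    have := mul_nonneg t0 t4
    have := mul_nonneg t2 t5
    nlinarith [mul_nonneg hG0 (mul_nonneg t0 t4), mul_nonneg hH0 (mul_nonneg t0 t4),
      mul_nonneg hH0 (mul_nonneg t2 t5)]
  · have e : QH H v w y = ∑ α, ∑ β, H α β * (Av v y α * pd β w y
        - pd 0 v y * (Xv y α * Av w y β)) := by
      have h0 := hnH (Xv y) (Xv_null y hy)
      have : QH H v w y = QH H v w y - (pd 0 v y * pd 0 w y) *
        ∑ α, ∑ β, H α β * Xv y α * Xv y β := by rw [h0]; ring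
      rw [this]
      unfold QH
      simp only [Finset.mul_sum, ← Finset.sum_sub_distrib]
      refine Finset.sum_congr rfl fun α _ => Finset.sum_congr rfl fun β _ => ?_
      rw [Av_eq v y α, Av_eq w y β]
      ring
    have b : |QH H v w y| ≤ CH * (normT v y * normD w y + normD v y * normT w y) := by
      rw [e, hCH]
      simp only [Finset.sum_mul]
      refine (Finset.abs_sum_le_sum_abs _ _).trans (Finset.sum_le_sum fun α _ => ?_)
      refine (Finset.abs_sum_le_sum_abs _ _).trans (Finset.sum_le_sum fun β _ => ?_)
      refine m2 le_rfl ?_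
      have b1 := m2 (Av_le v y α) (pd_le w y β)
      have b2 := m2 (pd_le v y 0) (m2 (hX α) (Av_le w y β))
      rw [abs_le] at *
      constructor <;> linarith
    refine b.trans (mul_le_mul_of_nonneg_right (by linarith) (by positivity))
end
end

section
/- Suppose {G^{αβγ}} satisfies the null condition. Then there exists a constant C > 0, depending only on the coefficients, such that for all smooth v, w on (0,∞)×ℝ³ and all (t,x) with t > 0, x ≠ 0: |G^{αβγ}(∂_γ v)(∂²_{αβ} w)| ≤ C(1+t)^{−1} Σ_{|a|=1}(|Z^a v||∂²w| + |∂v||∂Z^a w|). Similarly, if {H^{αβ}} satisfies the null condition then |H^{αβ}(∂_α v)(∂_β w)| ≤ C(1+t)^{−1} Σ_{|a|=1}(|Z^a v||∂w| + |∂v||Z^a w|), where the sums run over all eleven Klainerman vector fields Z^a with |a| = 1. -/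
open MeasureTheory Real Set

noncomputable section

lemma fd_expand (u : (Fin 4 → ℝ) → ℝ) (y V : Fin 4 → ℝ) :
    fderiv ℝ u y V = V 0 * pd 0 u y + V 1 * pd 1 u y + V 2 * pd 2 u y + V 3 * pd 3 u y := by
  have h : V = ∑ i, V i • (Pi.single i (1:ℝ) : Fin 4 → ℝ) := by
    ext j; simp [Finset.sum_apply, Pi.single_apply]
  conv_lhs => rw [h]
  simp [map_sum, Fin.sum_univ_four, pd, -Fin.isValue]

lemma Zop_d (u : (Fin 4 → ℝ) → ℝ) (y : Fin 4 → ℝ) :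
    Zop 0 u y = pd 0 u y ∧ Zop 1 u y = pd 1 u y ∧ Zop 2 u y = pd 2 u y ∧ Zop 3 u y = pd 3 u y := by
  refine ⟨?_, ?_, ?_, ?_⟩ <;> simp [Zop, KVF, pd]

lemma Zop_r (u : (Fin 4 → ℝ) → ℝ) (y : Fin 4 → ℝ) :
    Zop 4 u y = y 1 * pd 2 u y - y 2 * pd 1 u y ∧
    Zop 5 u y = y 1 * pd 3 u y - y 3 * pd 1 u y ∧
    Zop 6 u y = y 2 * pd 3 u y - y 3 * pd 2 u y ∧
    Zop 7 u y = y 1 * pd 0 u y + y 0 * pd 1 u y ∧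
    Zop 8 u y = y 2 * pd 0 u y + y 0 * pd 2 u y ∧
    Zop 9 u y = y 3 * pd 0 u y + y 0 * pd 3 u y ∧
    Zop 10 u y = y 0 * pd 0 u y + y 1 * pd 1 u y + y 2 * pd 2 u y + y 3 * pd 3 u y := by
  refine ⟨?_, ?_, ?_, ?_, ?_, ?_, ?_⟩ <;> simp [Zop, KVF, fd_expand, Pi.single_apply] <;> ring

lemma pd_smooth {w : (Fin 4 → ℝ) → ℝ} (hw : ContDiff ℝ (⊤ : ℕ∞) w) (j : Fin 4) :
    ContDiff ℝ (⊤ : ℕ∞) (pd j w) := by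
  unfold pd
  exact (hw.fderiv_right (m := (⊤ : ℕ∞)) (by simp)).clm_apply contDiff_const

lemma pd_diff {w : (Fin 4 → ℝ) → ℝ} (hw : ContDiff ℝ (⊤ : ℕ∞) w) (j : Fin 4) :
    Differentiable ℝ (pd j w) := (pd_smooth hw j).differentiable (by simp)

lemma pd_symm {w : (Fin 4 → ℝ) → ℝ} (hw : ContDiff ℝ (⊤ : ℕ∞) w) (i j : Fin 4) (y : Fin 4 → ℝ) :
    pd i (pd j w) y = pd j (pd i w) y := by
  have hd : DifferentiableAt ℝ (fderiv ℝ w) y :=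
    ((hw.fderiv_right (m := (⊤ : ℕ∞)) (by simp)).differentiable (by simp)) y
  have hs : IsSymmSndFDerivAt ℝ w y :=
    hw.contDiffAt.isSymmSndFDerivAt (by simp; exact WithTop.coe_le_coe.2 le_top)
  have key : ∀ i j, pd i (pd j w) y
      = fderiv ℝ (fderiv ℝ w) y (Pi.single i 1) (Pi.single j 1) := by
    intro i j
    unfold pd
    rw [fderiv_clm_apply hd (differentiableAt_const _)]
    simp
  rw [key, key]; exact hs _ _

lemma pd_mul {f : (Fin 4 → ℝ) → ℝ} (hf : Differentiable ℝ f) (b i : Fin 4) (y : Fin 4 → ℝ) :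
    pd b (fun z => z i * f z) y = (if i = b then 1 else 0) * f y + y i * pd b f y := by
  unfold pd
  have h1 : HasFDerivAt (fun z : Fin 4 → ℝ => z i) (ContinuousLinearMap.proj (R := ℝ) i) y :=
    (ContinuousLinearMap.proj (R := ℝ) (φ := fun _ : Fin 4 => ℝ) i).hasFDerivAt
  rw [(h1.fun_mul (hf y).hasFDerivAt).fderiv]
  simp [Pi.single_apply]
  ring

lemma mul_diff {f : (Fin 4 → ℝ) → ℝ} (hf : Differentiable ℝ f) (i : Fin 4) :
    Differentiable ℝ (fun z : Fin 4 → ℝ => z i * f z) := by fun_prop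

lemma pd_add {f g : (Fin 4 → ℝ) → ℝ} (hf : Differentiable ℝ f) (hg : Differentiable ℝ g)
    (b : Fin 4) (y : Fin 4 → ℝ) : pd b (fun z => f z + g z) y = pd b f y + pd b g y := by
  unfold pd; rw [fderiv_fun_add (hf y) (hg y)]; rfl

lemma pd_sub {f g : (Fin 4 → ℝ) → ℝ} (hf : Differentiable ℝ f) (hg : Differentiable ℝ g)
    (b : Fin 4) (y : Fin 4 → ℝ) : pd b (fun z => f z - g z) y = pd b f y - pd b g y := by
  unfold pd; rw [fderiv_fun_sub (hf y) (hg y)]; rfl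

/-- rotation derivative -/
lemma pd_rot {w : (Fin 4 → ℝ) → ℝ} (hw : ContDiff ℝ (⊤ : ℕ∞) w) (b i j : Fin 4) (y : Fin 4 → ℝ) :
    pd b (fun z => z i * pd j w z - z j * pd i w z) y =
      y i * pd b (pd j w) y - y j * pd b (pd i w) y
      + (if i = b then 1 else 0) * pd j w y - (if j = b then 1 else 0) * pd i w y := by
  rw [pd_sub (mul_diff (pd_diff hw j) i) (mul_diff (pd_diff hw i) j),
    pd_mul (pd_diff hw j), pd_mul (pd_diff hw i)]
  ring

lemma pd_boost {w : (Fin 4 → ℝ) → ℝ} (hw : ContDiff ℝ (⊤ : ℕ∞) w) (b i j : Fin 4) (y : Fin 4 → ℝ) :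
    pd b (fun z => z i * pd j w z + z j * pd i w z) y =
      y i * pd b (pd j w) y + y j * pd b (pd i w) y
      + (if i = b then 1 else 0) * pd j w y + (if j = b then 1 else 0) * pd i w y := by
  rw [pd_add (mul_diff (pd_diff hw j) i) (mul_diff (pd_diff hw i) j),
    pd_mul (pd_diff hw j), pd_mul (pd_diff hw i)]
  ring

lemma pd_scal {w : (Fin 4 → ℝ) → ℝ} (hw : ContDiff ℝ (⊤ : ℕ∞) w) (b : Fin 4) (y : Fin 4 → ℝ) :
    pd b (fun z => z 0 * pd 0 w z + z 1 * pd 1 w z + z 2 * pd 2 w z + z 3 * pd 3 w z) y =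
      y 0 * pd b (pd 0 w) y + y 1 * pd b (pd 1 w) y + y 2 * pd b (pd 2 w) y
        + y 3 * pd b (pd 3 w) y + pd b w y := by
  have h := fun j => mul_diff (pd_diff hw j) j
  rw [pd_add (((h 0).fun_add (h 1)).fun_add (h 2)) (h 3), pd_add ((h 0).fun_add (h 1)) (h 2),
    pd_add (h 0) (h 1), pd_mul (pd_diff hw 0), pd_mul (pd_diff hw 1), pd_mul (pd_diff hw 2),
    pd_mul (pd_diff hw 3)]
  fin_cases b <;> simp <;> ring

lemma bdm {c m M : ℝ} (hc : |c| ≤ 1) (hm : |m| ≤ M) : |c * m| ≤ M := by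
  rw [abs_mul]
  nlinarith [abs_nonneg c, abs_nonneg m]

lemma alg0 {t r u1 u2 u3 p0 p1 p2 p3 M : ℝ} (ht : 0 < t) (hr : 0 < r)
    (hu : u1 ^ 2 + u2 ^ 2 + u3 ^ 2 = 1) (h1 : |u1| ≤ 1) (h2 : |u2| ≤ 1) (h3 : |u3| ≤ 1)
    (hL1 : |r * u1 * p0 + t * p1| ≤ M) (hL2 : |r * u2 * p0 + t * p2| ≤ M)
    (hL3 : |r * u3 * p0 + t * p3| ≤ M)
    (hS : |t * p0 + r * u1 * p1 + r * u2 * p2 + r * u3 * p3| ≤ M) :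
    |(t - r) * p0| ≤ 3 * M := by
  have b1 := abs_le.1 (bdm h1 hL1)
  have b2 := abs_le.1 (bdm h2 hL2)
  have b3 := abs_le.1 (bdm h3 hL3)
  have bS := abs_le.1 hS
  have id : (t + r) * ((t - r) * p0) = t * (t * p0 + r * u1 * p1 + r * u2 * p2 + r * u3 * p3)
      - r * (u1 * (r * u1 * p0 + t * p1) + u2 * (r * u2 * p0 + t * p2)
        + u3 * (r * u3 * p0 + t * p3)) := by
    linear_combination (-r ^ 2 * p0) * (-hu)
  have hM : 0 ≤ M := (abs_nonneg _).trans hS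
  generalize t * p0 + r * u1 * p1 + r * u2 * p2 + r * u3 * p3 = s at *
  generalize u1 * (r * u1 * p0 + t * p1) = l1 at *
  generalize u2 * (r * u2 * p0 + t * p2) = l2 at *
  generalize u3 * (r * u3 * p0 + t * p3) = l3 at *
  have htr : 0 < t + r := by linarith
  rw [abs_le]
  constructor
  · refine le_of_mul_le_mul_left ?_ htr
    rw [id]; nlinarith
  · refine le_of_mul_le_mul_left ?_ htr
    rw [id]; nlinarith

lemma alg1 {t r u p0 p M : ℝ} (ht : 0 < t)
    (hu : |u| ≤ 1) (hL : |r * u * p0 + t * p| ≤ M) (hp0 : |p0| ≤ M) (hp : |p| ≤ M)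
    (h0 : |(t - r) * p0| ≤ 3 * M) : t * |p + u * p0| ≤ 4 * M ∧ (1 + t) * |p + u * p0| ≤ 6 * M := by
  have a := abs_le.1 (bdm hu h0)
  have b := abs_le.1 (bdm hu hp0)
  have c := abs_le.1 hL
  have d := abs_le.1 hp
  have e1 : t * |p + u * p0| ≤ 4 * M := by
    have e0 : t * |p + u * p0| = |t * (p + u * p0)| := by rw [abs_mul, abs_of_pos ht]
    rw [e0, abs_le]
    constructor <;> nlinarith
  have e2 : |p + u * p0| ≤ 2 * M := by
    rw [abs_le]; constructor <;> linarith
  exact ⟨e1, by linarith⟩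

lemma alg2 {t r u p0 p M : ℝ} (hr : 0 < r) (hrt : r ≤ 2 * t)
    (hu : |u| ≤ 1) (hT : t * |p + u * p0| ≤ 4 * M)
    (h0 : |(t - r) * p0| ≤ 3 * M) : |(t - r) * p| ≤ 7 * M := by
  have a := bdm hu h0
  have h : (t - r) * p = (t - r) * (p + u * p0) - u * ((t - r) * p0) := by ring
  have h2 : |(t - r) * (p + u * p0)| ≤ 4 * M := by
    rw [abs_mul]
    have : |t - r| ≤ t := by rw [abs_le]; constructor <;> linarith
    nlinarith [abs_nonneg (p + u * p0)]
  rw [h]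
  exact (abs_sub _ _).trans (by linarith)

lemma alg3 {t r u p0 p M : ℝ} (ht : 0 < t) (hrt : 2 * t ≤ r)
    (hu : |u| ≤ 1) (hL : |r * u * p0 + t * p| ≤ M)
    (h0 : |(t - r) * p0| ≤ 3 * M) : t * |p0| ≤ 3 * M ∧ t * |p| ≤ 7 * M := by
  have e0 : (r - t) * |p0| ≤ 3 * M := by
    rw [abs_mul, abs_of_neg (by linarith : t - r < 0)] at h0; linarith
  have := abs_nonneg p0
  refine ⟨by nlinarith, ?_⟩
  have e00 : t * |p| = |t * p| := by rw [abs_mul, abs_of_pos ht]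
  rw [e00]
  have e1 : |r * p0| ≤ 6 * M := by
    rw [abs_mul, abs_of_pos (by linarith : 0 < r)]; nlinarith
  have e2 := bdm hu e1
  have : t * p = (r * u * p0 + t * p) - u * (r * p0) := by ring
  rw [this]
  exact (abs_sub _ _).trans (by linarith)

/-- the bound for first derivatives of `w` -/
lemma alg4 {t r : ℝ} {u : Fin 4 → ℝ} {q : Fin 4 → ℝ} {h : Fin 4 → Fin 4 → ℝ} {M N : ℝ}
    (ht : 0 < t) (hr : 0 < r) (hrt : r ≤ 2 * t)
    (hu : u 1 ^ 2 + u 2 ^ 2 + u 3 ^ 2 = 1) (h1 : |u 1| ≤ 1) (h2 : |u 2| ≤ 1) (h3 : |u 3| ≤ 1)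
    (hs : ∀ a b, h a b = h b a)
    (hN : ∀ a b, |(t - r) * h a b| ≤ N)
    (hS : ∀ b, |t * h b 0 + r * u 1 * h b 1 + r * u 2 * h b 2 + r * u 3 * h b 3 + q b| ≤ M)
    (hL : ∀ b i, i ≠ 0 → |r * u i * h b 0 + t * h b i
      + (if i = b then 1 else 0) * q 0 + (if 0 = b then 1 else 0) * q i| ≤ M)
    (hR : ∀ b i j, i ≠ 0 → j ≠ 0 → i ≠ j → |r * u i * h b j - r * u j * h b i
      + (if i = b then 1 else 0) * q j - (if j = b then 1 else 0) * q i| ≤ M) :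
    ∀ a, |q a| ≤ 1000 * (M + N) := by
  have hM : 0 ≤ M := (abs_nonneg _).trans (hS 0)
  have hN0 : 0 ≤ N := (abs_nonneg _).trans (hN 0 0)
  have htr : 0 < t + r := by linarith
  have hui : ∀ i : Fin 4, i ≠ 0 → |u i| ≤ 1 := by
    intro i hi; fin_cases i <;> simp_all
  have huu : ∀ i j : Fin 4, i ≠ 0 → j ≠ 0 → |u i * u j| ≤ 1 :=
    fun i j hi hj => bdm (hui i hi) (hui j hj)
  -- e = q_0 + q_r
  have he : |q 0 + (u 1 * q 1 + u 2 * q 2 + u 3 * q 3)| ≤ 10 * (M + N) := by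
    have l := fun b i hi => abs_le.1 (hL b i hi)
    have ll := fun j i hi hj => abs_le.1 (bdm (huu i j hi hj) (hL j i hi))
    have rr := fun i j hi hj hij => abs_le.1 (bdm (hui i hi) (hR j i j hi hj hij))
    have nn := fun a b => abs_le.1 (hN a b)
    have nu := fun i j hi hj => abs_le.1 (bdm (huu i j hi hj) (hN i j))
    have l1 := l 1 1 (by decide)
    have l2 := l 2 2 (by decide)
    have l3 := l 3 3 (by decide)
    have l11 := ll 1 1 (by decide) (by decide)
    have l12 := ll 1 2 (by decide) (by decide)
    have l13 := ll 1 3 (by decide) (by decide)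
    have l21 := ll 2 1 (by decide) (by decide)
    have l22 := ll 2 2 (by decide) (by decide)
    have l23 := ll 2 3 (by decide) (by decide)
    have l31 := ll 3 1 (by decide) (by decide)
    have l32 := ll 3 2 (by decide) (by decide)
    have l33 := ll 3 3 (by decide) (by decide)
    have r12 := rr 1 2 (by decide) (by decide) (by decide)
    have r13 := rr 1 3 (by decide) (by decide) (by decide)
    have r21 := rr 2 1 (by decide) (by decide) (by decide)
    have r23 := rr 2 3 (by decide) (by decide) (by decide)
    have r31 := rr 3 1 (by decide) (by decide) (by decide)
    have r32 := rr 3 2 (by decide) (by decide) (by decide)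
    have n1 := nn 1 1
    have n2 := nn 2 2
    have n3 := nn 3 3
    have n11 := nu 1 1 (by decide) (by decide)
    have n12 := nu 1 2 (by decide) (by decide)
    have n13 := nu 1 3 (by decide) (by decide)
    have n21 := nu 2 1 (by decide) (by decide)
    have n22 := nu 2 2 (by decide) (by decide)
    have n23 := nu 2 3 (by decide) (by decide)
    have n31 := nu 3 1 (by decide) (by decide)
    have n32 := nu 3 2 (by decide) (by decide)
    have n33 := nu 3 3 (by decide) (by decide)
    clear l ll rr nn nu hL hR hS hN
    have s10 := hs 1 0
    have s20 := hs 2 0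
    have s30 := hs 3 0
    have s21 := hs 2 1
    have s31 := hs 3 1
    have s32 := hs 3 2
    clear hs hui huu
    simp only [Fin.isValue, s10, s20, s30, s21, s31, s32, if_true, one_mul, zero_mul, add_zero, sub_zero, Fin.reduceEq, if_false] at *
    have k0 : (u 1 ^ 2 + u 2 ^ 2 + u 3 ^ 2) * q 0 = q 0 := by rw [hu, one_mul]
    have k1 : (u 1 ^ 2 + u 2 ^ 2 + u 3 ^ 2) * (r * u 1 * h 0 1) = r * u 1 * h 0 1 := by
      rw [hu, one_mul]
    have k2 : (u 1 ^ 2 + u 2 ^ 2 + u 3 ^ 2) * (r * u 2 * h 0 2) = r * u 2 * h 0 2 := by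
      rw [hu, one_mul]
    have k3 : (u 1 ^ 2 + u 2 ^ 2 + u 3 ^ 2) * (r * u 3 * h 0 3) = r * u 3 * h 0 3 := by
      rw [hu, one_mul]
    have m1 : (u 1 ^ 2 + u 2 ^ 2 + u 3 ^ 2) * (r * h 1 1) = r * h 1 1 := by rw [hu, one_mul]
    have m2 : (u 1 ^ 2 + u 2 ^ 2 + u 3 ^ 2) * (r * h 2 2) = r * h 2 2 := by rw [hu, one_mul]
    have m3 : (u 1 ^ 2 + u 2 ^ 2 + u 3 ^ 2) * (r * h 3 3) = r * h 3 3 := by rw [hu, one_mul]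
    rw [abs_le]
    constructor <;> linarith
  -- contracted second order relations
  have hrel : ∀ b, |t * q b - ((if 1 = b then 1 else 0) * (r * u 1 * q 0)
      + (if 2 = b then 1 else 0) * (r * u 2 * q 0) + (if 3 = b then 1 else 0) * (r * u 3 * q 0))
      - (if 0 = b then 1 else 0) * (r * (u 1 * q 1 + u 2 * q 2 + u 3 * q 3))|
      ≤ (t + r) * (N + 3 * M) := by
    intro b
    have l1 := abs_le.1 (bdm h1 (hL b 1 (by decide)))
    have l2 := abs_le.1 (bdm h2 (hL b 2 (by decide)))
    have l3 := abs_le.1 (bdm h3 (hL b 3 (by decide)))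
    have s := abs_le.1 (hS b)
    have n := abs_le.1 (hN b 0)
    have k : (u 1 ^ 2 + u 2 ^ 2 + u 3 ^ 2) * h b 0 = h b 0 := by rw [hu, one_mul]
    generalize (if (1 : Fin 4) = b then (1 : ℝ) else 0) = d1 at *
    generalize (if (2 : Fin 4) = b then (1 : ℝ) else 0) = d2 at *
    generalize (if (3 : Fin 4) = b then (1 : ℝ) else 0) = d3 at *
    generalize (if (0 : Fin 4) = b then (1 : ℝ) else 0) = d0 at *
    have id : t * q b - (d1 * (r * u 1 * q 0) + d2 * (r * u 2 * q 0) + d3 * (r * u 3 * q 0))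
        - d0 * (r * (u 1 * q 1 + u 2 * q 2 + u 3 * q 3))
        = t * (t * h b 0 + r * u 1 * h b 1 + r * u 2 * h b 2 + r * u 3 * h b 3 + q b)
          - r * (u 1 * (r * u 1 * h b 0 + t * h b 1 + d1 * q 0 + d0 * q 1)
            + u 2 * (r * u 2 * h b 0 + t * h b 2 + d2 * q 0 + d0 * q 2)
            + u 3 * (r * u 3 * h b 0 + t * h b 3 + d3 * q 0 + d0 * q 3))
          - (t + r) * ((t - r) * h b 0) := by
      linear_combination r ^ 2 * k
    rw [id]
    generalize u 1 * (r * u 1 * h b 0 + t * h b 1 + d1 * q 0 + d0 * q 1) = x1 at *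
    generalize u 2 * (r * u 2 * h b 0 + t * h b 2 + d2 * q 0 + d0 * q 2) = x2 at *
    generalize u 3 * (r * u 3 * h b 0 + t * h b 3 + d3 * q 0 + d0 * q 3) = x3 at *
    generalize t * h b 0 + r * u 1 * h b 1 + r * u 2 * h b 2 + r * u 3 * h b 3 + q b = x0 at *
    generalize (t - r) * h b 0 = x4 at *
    rw [abs_le]
    have a1 : |t * x0| ≤ t * (3 * M) := by
      rw [abs_mul, abs_of_pos ht]
      exact mul_le_mul_of_nonneg_left (by rw [abs_le]; constructor <;> linarith) ht.le
    have a2 : |r * (x1 + x2 + x3)| ≤ r * (3 * M) := by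
      rw [abs_mul, abs_of_pos hr]
      exact mul_le_mul_of_nonneg_left (by rw [abs_le]; constructor <;> linarith) hr.le
    have a3 : |(t + r) * x4| ≤ (t + r) * N := by
      rw [abs_mul, abs_of_pos htr]
      exact mul_le_mul_of_nonneg_left (by rw [abs_le]; constructor <;> linarith) htr.le
    have a1 := abs_le.1 a1
    have a2 := abs_le.1 a2
    have a3 := abs_le.1 a3
    constructor <;> linarith
  have hq0 : |q 0| ≤ 13 * (M + N) := by
    have a := hrel 0
    simp only [Fin.isValue, if_true, one_mul, zero_mul, add_zero, sub_zero, Fin.reduceEq,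
      if_false] at a
    have a := abs_le.1 a
    have he' : |r * (q 0 + (u 1 * q 1 + u 2 * q 2 + u 3 * q 3))| ≤ r * (10 * (M + N)) := by
      rw [abs_mul, abs_of_pos hr]
      exact mul_le_mul_of_nonneg_left he hr.le
    have b := abs_le.1 he'
    have p1 := mul_nonneg ht.le hM
    have p2 := mul_nonneg ht.le hN0
    have p3 := mul_nonneg hr.le hM
    have p4 := mul_nonneg hr.le hN0
    rw [abs_le]
    constructor
    · refine le_of_mul_le_mul_left ?_ htr
      linarith
    · refine le_of_mul_le_mul_left ?_ htr
      linarith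
  have hqi : ∀ i : Fin 4, i ≠ 0 → |t * q i - r * u i * q 0| ≤ (t + r) * (N + 3 * M) →
      |q i| ≤ 1000 * (M + N) := by
    intro i hi h
    have a := abs_le.1 h
    have he' : |r * (u i * q 0)| ≤ r * (13 * (M + N)) := by
      rw [abs_mul, abs_of_pos hr]
      exact mul_le_mul_of_nonneg_left (bdm (hui i hi) hq0) hr.le
    have b := abs_le.1 he'
    have p1 := mul_nonneg ht.le hM
    have p2 := mul_nonneg ht.le hN0
    have p3 := mul_le_mul_of_nonneg_right hrt hM
    have p4 := mul_le_mul_of_nonneg_right hrt hN0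
    rw [abs_le]
    constructor
    · refine le_of_mul_le_mul_left ?_ ht
      linarith
    · refine le_of_mul_le_mul_left ?_ ht
      linarith
  have g1 := hqi 1 (by decide) (by simpa using hrel 1)
  have g2 := hqi 2 (by decide) (by simpa using hrel 2)
  have g3 := hqi 3 (by decide) (by simpa using hrel 3)
  intro a
  fin_cases a
  · exact hq0.trans (by linarith)
  · exact g1
  · exact g2
  · exact g3

lemma good {t r : ℝ} {u : Fin 4 → ℝ} {y : Fin 4 → ℝ} (ht : 0 < t) (hr : 0 < r) (hy0 : y 0 = t)
    (hy : ∀ i, i ≠ 0 → y i = r * u i) (hu0 : u 0 = -1) (hui : ∀ i, |u i| ≤ 1)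
    (hu : u 1 ^ 2 + u 2 ^ 2 + u 3 ^ 2 = 1) (f : (Fin 4 → ℝ) → ℝ) {M : ℝ}
    (hd : ∀ a, |pd a f y| ≤ M)
    (hL : ∀ i, i ≠ 0 → |y i * pd 0 f y + y 0 * pd i f y| ≤ M)
    (hS : |y 0 * pd 0 f y + y 1 * pd 1 f y + y 2 * pd 2 f y + y 3 * pd 3 f y| ≤ M) :
    (∀ a, (1 + t) * |pd a f y + u a * pd 0 f y| ≤ 6 * M) ∧
    (r ≤ 2 * t → ∀ a, |(t - r) * pd a f y| ≤ 7 * M) ∧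
    (2 * t ≤ r → ∀ a, (1 + t) * |pd a f y| ≤ 8 * M) := by
  have hM : 0 ≤ M := (abs_nonneg _).trans (hd 0)
  have hL' : ∀ i, i ≠ 0 → |r * u i * pd 0 f y + t * pd i f y| ≤ M := by
    intro i hi
    have := hL i hi
    rwa [hy i hi, hy0] at this
  rw [hy 1 (by decide), hy 2 (by decide), hy 3 (by decide), hy0] at hS
  have h0 : |(t - r) * pd 0 f y| ≤ 3 * M :=
    alg0 ht hr hu (hui 1) (hui 2) (hui 3) (hL' 1 (by decide)) (hL' 2 (by decide))
      (hL' 3 (by decide)) hS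
  refine ⟨?_, ?_, ?_⟩
  · intro a
    by_cases ha : a = 0
    · subst ha
      have : pd 0 f y + u 0 * pd 0 f y = 0 := by rw [hu0]; ring
      rw [this]; simp; exact hM
    · exact (alg1 ht (hui a) (hL' a ha) (hd 0) (hd a) h0).2
  · intro hrt a
    by_cases ha : a = 0
    · subst ha; linarith
    · exact alg2 hr hrt (hui a) (alg1 ht (hui a) (hL' a ha) (hd 0) (hd a) h0).1 h0
  · intro hrt a
    have h1 := hd a
    by_cases ha : a = 0
    · subst ha
      have := (alg3 ht hrt (hui 1) (hL' 1 (by decide)) h0).1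
      linarith
    · have := (alg3 ht hrt (hui a) (hL' a ha) h0).2
      linarith

lemma good_Z {t r : ℝ} {u : Fin 4 → ℝ} {y : Fin 4 → ℝ} (ht : 0 < t) (hr : 0 < r) (hy0 : y 0 = t)
    (hy : ∀ i, i ≠ 0 → y i = r * u i) (hu0 : u 0 = -1) (hui : ∀ i, |u i| ≤ 1)
    (hu : u 1 ^ 2 + u 2 ^ 2 + u 3 ^ 2 = 1) (f : (Fin 4 → ℝ) → ℝ) {M : ℝ}
    (hZ : ∀ i, |Zop i f y| ≤ M) :
    (∀ a, (1 + t) * |pd a f y + u a * pd 0 f y| ≤ 6 * M) ∧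
    (r ≤ 2 * t → ∀ a, |(t - r) * pd a f y| ≤ 7 * M) ∧
    (2 * t ≤ r → ∀ a, (1 + t) * |pd a f y| ≤ 8 * M) := by
  obtain ⟨d0, d1, d2, d3⟩ := Zop_d f y
  obtain ⟨r4, r5, r6, r7, r8, r9, r10⟩ := Zop_r f y
  refine good ht hr hy0 hy hu0 hui hu f ?_ ?_ ?_
  · intro a
    fin_cases a
    · exact d0 ▸ hZ 0
    · exact d1 ▸ hZ 1
    · exact d2 ▸ hZ 2
    · exact d3 ▸ hZ 3
  · intro i hi
    fin_cases i
    · exact absurd rfl hi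
    · exact r7 ▸ hZ 7
    · exact r8 ▸ hZ 8
    · exact r9 ▸ hZ 9
  · exact r10 ▸ hZ 10

lemma pd_Zop_s6 {w : (Fin 4 → ℝ) → ℝ} (hw : ContDiff ℝ (⊤ : ℕ∞) w) {y : Fin 4 → ℝ} {M : ℝ}
    (hM : ∀ i b, |pd b (Zop i w) y| ≤ M) :
    (∀ a b, |pd b (pd a w) y| ≤ M) ∧
    (∀ b, |y 0 * pd b (pd 0 w) y + y 1 * pd b (pd 1 w) y + y 2 * pd b (pd 2 w) y
        + y 3 * pd b (pd 3 w) y + pd b w y| ≤ M) ∧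
    (∀ b i, i ≠ 0 → |y i * pd b (pd 0 w) y + y 0 * pd b (pd i w) y
      + (if i = b then 1 else 0) * pd 0 w y + (if 0 = b then 1 else 0) * pd i w y| ≤ M) ∧
    (∀ b i j, i ≠ 0 → j ≠ 0 → i ≠ j → |y i * pd b (pd j w) y - y j * pd b (pd i w) y
      + (if i = b then 1 else 0) * pd j w y - (if j = b then 1 else 0) * pd i w y| ≤ M) := by
  have D := Zop_d w
  have R := Zop_r w
  refine ⟨?_, ?_, ?_, ?_⟩
  · intro a b
    fin_cases a
    · have := hM 0 b
      rwa [funext fun z => (D z).1] at this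
    · have := hM 1 b
      rwa [funext fun z => (D z).2.1] at this
    · have := hM 2 b
      rwa [funext fun z => (D z).2.2.1] at this
    · have := hM 3 b
      rwa [funext fun z => (D z).2.2.2] at this
  · intro b
    have := hM 10 b
    rwa [funext fun z => (R z).2.2.2.2.2.2, pd_scal hw] at this
  · intro b i hi
    rw [← pd_boost hw b i 0 y]
    fin_cases i
    · exact absurd rfl hi
    · have := hM 7 b
      rwa [funext fun z => (R z).2.2.2.1] at this
    · have := hM 8 b
      rwa [funext fun z => (R z).2.2.2.2.1] at this
    · have := hM 9 b
      rwa [funext fun z => (R z).2.2.2.2.2.1] at this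
  · intro b i j hi hj hij
    have key : ∀ i j : Fin 4, |pd b (fun z => z i * pd j w z - z j * pd i w z) y| ≤ M →
        |pd b (fun z => z j * pd i w z - z i * pd j w z) y| ≤ M := by
      intro i j h
      rw [pd_rot hw] at h ⊢
      rw [← abs_neg]
      refine le_trans (le_of_eq ?_) h
      congr 1; ring
    have k4 := hM 4 b
    rw [funext fun z => (R z).1] at k4
    have k5 := hM 5 b
    rw [funext fun z => (R z).2.1] at k5
    have k6 := hM 6 b
    rw [funext fun z => (R z).2.2.1] at k6
    rw [← pd_rot hw b i j y]
    fin_cases i <;> fin_cases j <;> first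
      | exact absurd rfl hi
      | exact absurd rfl hj
      | exact absurd rfl hij
      | exact k4
      | exact k5
      | exact k6
      | exact key _ _ k4
      | exact key _ _ k5
      | exact key _ _ k6

lemma pd_le_normD (v : (Fin 4 → ℝ) → ℝ) (y : Fin 4 → ℝ) (a : Fin 4) : |pd a v y| ≤ normD v y := by
  unfold normD
  apply Real.abs_le_sqrt
  exact Finset.single_le_sum (f := fun a => pd a v y ^ 2) (fun i _ => sq_nonneg _) (Finset.mem_univ a)

lemma pd_le_normD2 (v : (Fin 4 → ℝ) → ℝ) (y : Fin 4 → ℝ) (a b : Fin 4) :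
    |pd a (pd b v) y| ≤ normD2 v y := by
  unfold normD2
  apply Real.abs_le_sqrt
  refine le_trans (Finset.single_le_sum (f := fun b => pd a (pd b v) y ^ 2)
    (fun i _ => sq_nonneg _) (Finset.mem_univ b)) ?_
  exact Finset.single_le_sum (f := fun a => ∑ b, pd a (pd b v) y ^ 2)
    (fun i _ => Finset.sum_nonneg fun j _ => sq_nonneg _) (Finset.mem_univ a)

/-- second derivative bound -/
lemma T2 {t r : ℝ} {u : Fin 4 → ℝ} {y : Fin 4 → ℝ} (ht : 0 < t) (hr : 0 < r) (hy0 : y 0 = t)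
    (hy : ∀ i, i ≠ 0 → y i = r * u i) (hu0 : u 0 = -1) (hui : ∀ i, |u i| ≤ 1)
    (hu : u 1 ^ 2 + u 2 ^ 2 + u 3 ^ 2 = 1) {w : (Fin 4 → ℝ) → ℝ}
    (hw : ContDiff ℝ (⊤ : ℕ∞) w) (hrt : r ≤ 2 * t) {M N : ℝ}
    (hM : ∀ i b, |pd b (Zop i w) y| ≤ M)
    (hN : ∀ a b, |pd a (pd b w) y| ≤ N) (a b : Fin 4) :
    (1 + t) * |pd a (pd b w) y + u a * pd 0 (pd b w) y| ≤ 6 * (M + 2000 * (M + |t - r| * N)) := by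
  obtain ⟨z1, z2, z3, z4⟩ := pd_Zop_s6 hw hM
  have hM0 : 0 ≤ M := (abs_nonneg _).trans (hM 0 0)
  have hN0 : 0 ≤ |t - r| * N := mul_nonneg (abs_nonneg _) ((abs_nonneg _).trans (hN 0 0))
  have hq : ∀ a, |pd a w y| ≤ 1000 * (M + |t - r| * N) := by
    refine alg4 (t := t) (r := r) (u := u) (q := fun a => pd a w y)
      (h := fun a b => pd a (pd b w) y) ht hr hrt hu (hui 1) (hui 2) (hui 3)
      (fun a b => pd_symm hw a b y) ?_ ?_ ?_ ?_
    · intro a b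
      rw [abs_mul]
      exact mul_le_mul_of_nonneg_left (hN a b) (abs_nonneg _)
    · intro b
      have := z2 b
      rwa [hy 1 (by decide), hy 2 (by decide), hy 3 (by decide), hy0] at this
    · intro b i hi
      have := z3 b i hi
      rwa [hy i hi, hy0] at this
    · intro b i j hi hj hij
      have := z4 b i j hi hj hij
      rwa [hy i hi, hy j hj] at this
  have hdq : ∀ (i b c : Fin 4), |(if i = b then 1 else 0) * pd c w y| ≤ 1000 * (M + |t - r| * N) :=
    fun i b c => bdm (by split_ifs <;> simp) (hq c)
  refine (good ht hr hy0 hy hu0 hui hu (pd b w) ?_ ?_ ?_).1 a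
  · intro a
    exact (z1 b a).trans (by linarith)
  · intro i hi
    have h1 := abs_le.1 (z3 b i hi)
    have h2 := abs_le.1 (hdq i b 0)
    have h3 := abs_le.1 (hdq 0 b i)
    rw [pd_symm hw 0 b, pd_symm hw i b, abs_le]
    constructor <;> linarith
  · have h1 := abs_le.1 (z2 b)
    have h2 := abs_le.1 (hq b)
    rw [pd_symm hw 0 b, pd_symm hw 1 b, pd_symm hw 2 b, pd_symm hw 3 b, abs_le]
    constructor <;> linarith

set_option maxHeartbeats 4000000

/-- **Lemma 2.3.** The null condition yields the extra time decay
`|G^{αβγ}(∂_γ v)(∂²_{αβ} w)| ≤ C(1+t)^{-1} Σ_{|a|=1}(|Z^a v||∂²w| + |∂v||∂Z^a w|)` and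
`|H^{αβ}(∂_α v)(∂_β w)| ≤ C(1+t)^{-1} Σ_{|a|=1}(|Z^a v||∂w| + |∂v||Z^a w|)`. -/
theorem stmt6_null_form_decay_estimate
    (G : Fin 4 → Fin 4 → Fin 4 → ℝ) (H : Fin 4 → Fin 4 → ℝ)
    (hnG : NullG G) (hnH : NullH H) :
    ∃ C > (0 : ℝ),
      ∀ v w : (Fin 4 → ℝ) → ℝ, ContDiff ℝ (⊤ : ℕ∞) v → ContDiff ℝ (⊤ : ℕ∞) w →
        ∀ y : Fin 4 → ℝ, 0 < y 0 → (fun i : Fin 3 => y i.succ) ≠ 0 →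
          |QG G v w y| ≤ C * (1 + y 0)⁻¹ *
              ∑ i : Fin 11, (|Zop i v y| * normD2 w y + normD v y * normD (Zop i w) y) ∧
          |QH H v w y| ≤ C * (1 + y 0)⁻¹ *
              ∑ i : Fin 11, (|Zop i v y| * normD w y + normD v y * |Zop i w y|) := by
  set BG : ℝ := ∑ α, ∑ β, ∑ γ, |G α β γ| with hBG
  set BH : ℝ := ∑ α, ∑ β, |H α β| with hBH
  have hBG0 : 0 ≤ BG := by positivity
  have hBH0 : 0 ≤ BH := by positivity
  refine ⟨1000000 * (BG + BH + 1), by positivity, ?_⟩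
  intro v w hv hw y ht hx
  set t := y 0 with hyt
  set r := Real.sqrt (y 1 ^ 2 + y 2 ^ 2 + y 3 ^ 2) with hrdef
  have hpos : 0 < y 1 ^ 2 + y 2 ^ 2 + y 3 ^ 2 := by
    by_contra hcon
    apply hx
    have e1 : y 1 = 0 := by nlinarith [sq_nonneg (y 1), sq_nonneg (y 2), sq_nonneg (y 3)]
    have e2 : y 2 = 0 := by nlinarith [sq_nonneg (y 1), sq_nonneg (y 2), sq_nonneg (y 3)]
    have e3 : y 3 = 0 := by nlinarith [sq_nonneg (y 1), sq_nonneg (y 2), sq_nonneg (y 3)]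
    funext i
    fin_cases i
    · exact e1
    · exact e2
    · exact e3
  have hr : 0 < r := Real.sqrt_pos.2 hpos
  have hr2 : r ^ 2 = y 1 ^ 2 + y 2 ^ 2 + y 3 ^ 2 := Real.sq_sqrt hpos.le
  obtain ⟨u, hu0, hui'⟩ : ∃ u : Fin 4 → ℝ, u 0 = -1 ∧ ∀ i, i ≠ 0 → u i = y i / r :=
    ⟨fun i => if i = 0 then -1 else y i / r, by simp, fun i hi => by simp [hi]⟩
  have hy : ∀ i, i ≠ 0 → y i = r * u i := by
    intro i hi; rw [hui' i hi]; field_simp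
  have hu : u 1 ^ 2 + u 2 ^ 2 + u 3 ^ 2 = 1 := by
    rw [hui' 1 (by decide), hui' 2 (by decide), hui' 3 (by decide)]
    field_simp
    exact hr2.symm
  have hui : ∀ i, |u i| ≤ 1 := by
    intro i
    fin_cases i
    · show |u 0| ≤ 1
      rw [hu0]; simp
    · show |u 1| ≤ 1
      exact (sq_le_one_iff_abs_le_one _).1 (by nlinarith [sq_nonneg (u 2), sq_nonneg (u 3)])
    · show |u 2| ≤ 1
      exact (sq_le_one_iff_abs_le_one _).1 (by nlinarith [sq_nonneg (u 1), sq_nonneg (u 3)])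
    · show |u 3| ≤ 1
      exact (sq_le_one_iff_abs_le_one _).1 (by nlinarith [sq_nonneg (u 1), sq_nonneg (u 2)])
  have ht1 : 0 < 1 + t := by linarith
  set Mv := ∑ i, |Zop i v y| with hMv
  have hZv : ∀ i, |Zop i v y| ≤ Mv := fun i =>
    Finset.single_le_sum (f := fun i => |Zop i v y|) (fun _ _ => abs_nonneg _) (Finset.mem_univ i)
  have hMv0 : 0 ≤ Mv := (abs_nonneg _).trans (hZv 0)
  obtain ⟨gv1, gv2, gv3⟩ := good_Z ht hr hyt.symm hy hu0 hui hu v hZv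
  set P := normD v y with hP
  have hp : ∀ a, |pd a v y| ≤ P := pd_le_normD v y
  have hP0 : 0 ≤ P := (abs_nonneg _).trans (hp 0)
  constructor
  · set N := normD2 w y with hNdef
    have hN : ∀ a b, |pd a (pd b w) y| ≤ N := pd_le_normD2 w y
    have hN0 : 0 ≤ N := (abs_nonneg _).trans (hN 0 0)
    set M := ∑ i, normD (Zop i w) y with hMdef
    have hM : ∀ i b, |pd b (Zop i w) y| ≤ M := fun i b =>
      (pd_le_normD _ y b).trans (Finset.single_le_sum (f := fun i => normD (Zop i w) y)
        (fun _ _ => Real.sqrt_nonneg _) (Finset.mem_univ i))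
    have hM0 : 0 ≤ M := (abs_nonneg _).trans (hM 0 0)
    have hsum : ∑ i : Fin 11, (|Zop i v y| * N + P * normD (Zop i w) y) = Mv * N + P * M := by
      rw [Finset.sum_add_distrib, ← Finset.sum_mul, ← Finset.mul_sum]
    rw [hsum]
    obtain ⟨Y, hYQ, hYb⟩ : ∃ Y : Fin 4 → Fin 4 → Fin 4 → ℝ,
        QG G v w y = ∑ α, ∑ β, ∑ γ, G α β γ * Y α β γ ∧
        ∀ α β γ, (1 + t) * |Y α β γ| ≤ 1000000 * (Mv * N + P * M) := by
      have q1 : 0 ≤ Mv * N := mul_nonneg hMv0 hN0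
      have q2 : 0 ≤ P * M := mul_nonneg hP0 hM0
      rcases le_total (2 * t) r with hrt | hrt
      · refine ⟨fun α β γ => pd γ v y * pd α (pd β w) y, ?_, ?_⟩
        · unfold QG
          simp only [mul_assoc]
        · intro α β γ
          rw [abs_mul, ← mul_assoc]
          have := mul_le_mul (gv3 hrt γ) (hN α β) (abs_nonneg _) (by positivity)
          linarith
      · set Th : Fin 4 → Fin 4 → ℝ := fun α β => pd α (pd β w) y + u α * pd 0 (pd β w) y with hTh
        have hThb : ∀ α β, (1 + t) * |Th α β| ≤ 6 * (M + 2000 * (M + |t - r| * N)) :=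
          fun α β => T2 ht hr hyt.symm hy hu0 hui hu hw hrt hM hN α β
        refine ⟨fun α β γ => (pd γ v y + u γ * pd 0 v y) * pd α (pd β w) y
          - u γ * (pd 0 v y * (Th α β - u α * Th β 0)), ?_, ?_⟩
        · have hnull := hnG u (by rw [hu0, hu]; norm_num)
          have : QG G v w y = QG G v w y
              + (pd 0 v y * pd 0 (pd 0 w) y) * ∑ α, ∑ β, ∑ γ, G α β γ * u α * u β * u γ := by
            rw [hnull]; ring
          rw [this]
          unfold QG
          simp only [Finset.mul_sum, ← Finset.sum_add_distrib]
          refine Finset.sum_congr rfl fun α _ => Finset.sum_congr rfl fun β _ =>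
            Finset.sum_congr rfl fun γ _ => ?_
          simp only [hTh]
          rw [pd_symm hw β 0]
          ring
        · intro α β γ
          have b1 : (1 + t) * |(pd γ v y + u γ * pd 0 v y) * pd α (pd β w) y| ≤ 6 * Mv * N := by
            rw [abs_mul, ← mul_assoc]
            exact mul_le_mul (gv1 γ) (hN α β) (abs_nonneg _) (by positivity)
          have b2 : (1 + t) * |Th α β - u α * Th β 0| ≤ 12 * (M + 2000 * (M + |t - r| * N)) := by
            have c1 : |u α * Th β 0| ≤ |Th β 0| := bdm (hui α) le_rfl
            have c2 := abs_sub (Th α β) (u α * Th β 0)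
            have c3 := hThb α β
            have c4 := hThb β 0
            have c5 : (1 + t) * |Th α β - u α * Th β 0| ≤ (1 + t) * (|Th α β| + |Th β 0|) :=
              mul_le_mul_of_nonneg_left (by linarith) ht1.le
            linarith
          have b3 : |pd 0 v y| * |t - r| ≤ 7 * Mv := by
            have := gv2 hrt 0
            rw [abs_mul] at this; linarith
          have b4 : (1 + t) * |u γ * (pd 0 v y * (Th α β - u α * Th β 0))|
              ≤ |pd 0 v y| * (12 * (M + 2000 * (M + |t - r| * N))) := by
            have c1 : |u γ * (pd 0 v y * (Th α β - u α * Th β 0))|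
              ≤ |pd 0 v y * (Th α β - u α * Th β 0)| := bdm (hui γ) le_rfl
            rw [abs_mul (pd 0 v y)] at c1
            have c2 := mul_le_mul_of_nonneg_left c1 ht1.le
            have c3 := mul_le_mul_of_nonneg_left b2 (abs_nonneg (pd 0 v y))
            linarith
          have b5 := mul_le_mul_of_nonneg_right b3 hN0
          have b6 := mul_le_mul_of_nonneg_right (hp 0) hM0
          have b7 := mul_le_mul_of_nonneg_left (abs_sub
            ((pd γ v y + u γ * pd 0 v y) * pd α (pd β w) y)
            (u γ * (pd 0 v y * (Th α β - u α * Th β 0)))) ht1.le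
          linarith
    set K := Mv * N + P * M with hK
    have hK0 : 0 ≤ K := by positivity
    have hYb' : ∀ α β γ, |Y α β γ| ≤ 1000000 * (1 + t)⁻¹ * K := by
      intro α β γ
      have := hYb α β γ
      rw [mul_right_comm, ← div_eq_mul_inv, le_div_iff₀ ht1]
      linarith
    calc |QG G v w y| ≤ ∑ α, ∑ β, ∑ γ, |G α β γ| * (1000000 * (1 + t)⁻¹ * K) := by
          rw [hYQ]
          refine (Finset.abs_sum_le_sum_abs _ _).trans (Finset.sum_le_sum fun α _ => ?_)
          refine (Finset.abs_sum_le_sum_abs _ _).trans (Finset.sum_le_sum fun β _ => ?_)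
          refine (Finset.abs_sum_le_sum_abs _ _).trans (Finset.sum_le_sum fun γ _ => ?_)
          rw [abs_mul]
          exact mul_le_mul_of_nonneg_left (hYb' α β γ) (abs_nonneg _)
      _ = 1000000 * BG * (1 + t)⁻¹ * K := by
          simp only [← Finset.sum_mul]
          rw [← hBG]; ring
      _ ≤ _ := by gcongr; linarith
  · set N := normD w y with hNdef
    have hN : ∀ a, |pd a w y| ≤ N := pd_le_normD w y
    have hN0 : 0 ≤ N := (abs_nonneg _).trans (hN 0)
    set M := ∑ i, |Zop i w y| with hMdef
    have hZw : ∀ i, |Zop i w y| ≤ M := fun i =>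
      Finset.single_le_sum (f := fun i => |Zop i w y|) (fun _ _ => abs_nonneg _)
        (Finset.mem_univ i)
    have hM0 : 0 ≤ M := (abs_nonneg _).trans (hZw 0)
    have gw1 := (good_Z ht hr hyt.symm hy hu0 hui hu w hZw).1
    have hsum : ∑ i : Fin 11, (|Zop i v y| * N + P * |Zop i w y|) = Mv * N + P * M := by
      rw [Finset.sum_add_distrib, ← Finset.sum_mul, ← Finset.mul_sum]
    rw [hsum]
    obtain ⟨Y, hYQ, hYb⟩ : ∃ Y : Fin 4 → Fin 4 → ℝ,
        QH H v w y = ∑ α, ∑ β, H α β * Y α β ∧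
        ∀ α β, (1 + t) * |Y α β| ≤ 1000000 * (Mv * N + P * M) := by
      have q1 : 0 ≤ Mv * N := mul_nonneg hMv0 hN0
      have q2 : 0 ≤ P * M := mul_nonneg hP0 hM0
      refine ⟨fun α β => (pd α v y + u α * pd 0 v y) * pd β w y
          - u α * (pd 0 v y * (pd β w y + u β * pd 0 w y)), ?_, ?_⟩
      · have hnull := hnH u (by rw [hu0, hu]; norm_num)
        have : QH H v w y = QH H v w y
            - (pd 0 v y * pd 0 w y) * ∑ α, ∑ β, H α β * u α * u β := by
          rw [hnull]; ring
        rw [this]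
        unfold QH
        simp only [Finset.mul_sum, ← Finset.sum_sub_distrib]
        refine Finset.sum_congr rfl fun α _ => Finset.sum_congr rfl fun β _ => ?_
        ring
      · intro α β
        have b1 : (1 + t) * |(pd α v y + u α * pd 0 v y) * pd β w y| ≤ 6 * Mv * N := by
          rw [abs_mul, ← mul_assoc]
          exact mul_le_mul (gv1 α) (hN β) (abs_nonneg _) (by positivity)
        have b4 : (1 + t) * |u α * (pd 0 v y * (pd β w y + u β * pd 0 w y))| ≤ P * (6 * M) := by
          have c1 : |u α * (pd 0 v y * (pd β w y + u β * pd 0 w y))|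
            ≤ |pd 0 v y * (pd β w y + u β * pd 0 w y)| := bdm (hui α) le_rfl
          rw [abs_mul (pd 0 v y)] at c1
          have c2 := mul_le_mul_of_nonneg_left c1 ht1.le
          have c3 := mul_le_mul (hp 0) (gw1 β) (by positivity) hP0
          linarith
        have b7 := mul_le_mul_of_nonneg_left (abs_sub
            ((pd α v y + u α * pd 0 v y) * pd β w y)
            (u α * (pd 0 v y * (pd β w y + u β * pd 0 w y)))) ht1.le
        linarith
    set K := Mv * N + P * M with hK
    have hK0 : 0 ≤ K := by positivity
    have hYb' : ∀ α β, |Y α β| ≤ 1000000 * (1 + t)⁻¹ * K := by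
      intro α β
      have := hYb α β
      rw [mul_right_comm, ← div_eq_mul_inv, le_div_iff₀ ht1]
      linarith
    calc |QH H v w y| ≤ ∑ α, ∑ β, |H α β| * (1000000 * (1 + t)⁻¹ * K) := by
          rw [hYQ]
          refine (Finset.abs_sum_le_sum_abs _ _).trans (Finset.sum_le_sum fun α _ => ?_)
          refine (Finset.abs_sum_le_sum_abs _ _).trans (Finset.sum_le_sum fun β _ => ?_)
          rw [abs_mul]
          exact mul_le_mul_of_nonneg_left (hYb' α β) (abs_nonneg _)
      _ = 1000000 * BH * (1 + t)⁻¹ * K := by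
          simp only [← Finset.sum_mul]
          rw [← hBH]; ring
      _ ≤ _ := by gcongr; linarith
end
end

section
/- Let n ≥ 2 and let s satisfy 1/2 < s < n/2, and let p be defined by (n−1)/p = n/2 − s. Then there exists a constant C > 0 depending only on n and s such that for every function v on ℝⁿ decaying sufficiently fast as |x| → ∞ (e.g. v Schwartz) and every r > 0: r^{(n/2)−s} ‖v(r·)‖_{L^p(S^{n−1})} ≤ C ‖v‖_{Ḣ^s(ℝⁿ)}. -/
open MeasureTheory Real
open scoped FourierTransform

noncomputable section

/-- The homogeneous Sobolev norm `‖v‖_{Ḣ^s(ℝⁿ)} = ‖ |ξ|^s v̂(ξ) ‖_{L²(ℝⁿ)}`. -/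
def homSobolevNorm (n : ℕ) (s : ℝ) (v : EuclideanSpace ℝ (Fin n) → ℝ) : ℝ :=
  Real.sqrt (∫ ξ : EuclideanSpace ℝ (Fin n),
    ‖ξ‖ ^ (2 * s) * ‖𝓕 (fun x => (v x : ℂ)) ξ‖ ^ 2)

/-- The `L^p` norm of the restriction of `v` to the sphere of radius `r`,
with respect to the surface measure on the unit sphere. -/
def sphereLpNorm (n : ℕ) (p : ℝ) (v : EuclideanSpace ℝ (Fin n) → ℝ) (r : ℝ) : ℝ :=
  (∫ ω : Metric.sphere (0 : EuclideanSpace ℝ (Fin n)) 1,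
      |v (r • (ω : EuclideanSpace ℝ (Fin n)))| ^ p ∂((volume : Measure (EuclideanSpace ℝ (Fin n))).toSphere)) ^ (1 / p)

abbrev EE (n : ℕ) := EuclideanSpace ℝ (Fin n)
abbrev SS (n : ℕ) := Metric.sphere (0 : EuclideanSpace ℝ (Fin n)) 1
abbrev sg (n : ℕ) : Measure (SS n) := (volume : Measure (EuclideanSpace ℝ (Fin n))).toSphere

lemma polar (n : ℕ) (hn : 2 ≤ n) (f : EE n → ENNReal) (hf : Measurable f) :
    ∫⁻ z, f z = ∫⁻ y : SS n, (∫⁻ ρ in Set.Ioi (0:ℝ), ENNReal.ofReal (ρ ^ (n - 1)) * f (ρ • (y : EE n))) ∂(sg n) := by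
  have : Nonempty (Fin n) := ⟨⟨0, by omega⟩⟩
  have : Nontrivial (EE n) := inferInstance
  have h1 : ∫⁻ z, f z = ∫⁻ z : ({(0 : EE n)}ᶜ : Set (EE n)), f z ∂(Measure.comap (↑) (volume : Measure (EE n))) := by
    rw [lintegral_subtype_comap (measurableSet_singleton _).compl f]
    rw [restrict_compl_singleton]
  have h2 := (Measure.measurePreserving_homeomorphUnitSphereProd (volume : Measure (EE n)))
  have h3 := h2.symm (Homeomorph.toMeasurableEquiv (homeomorphUnitSphereProd (EE n)))
  rw [h1, ← h3.lintegral_comp_emb (MeasurableEquiv.measurableEmbedding _)]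
  rw [lintegral_prod]
  · refine lintegral_congr fun y => ?_
    rw [Measure.volumeIoiPow, lintegral_withDensity_eq_lintegral_mul]
    · rw [← lintegral_subtype_comap measurableSet_Ioi (fun ρ : ℝ => ENNReal.ofReal (ρ ^ (n - 1)) * f (ρ • (y : EE n)))]
      simp
    · fun_prop
    · refine (hf.comp measurable_subtype_coe).comp ?_
      exact (MeasurableEquiv.measurable _).comp measurable_prodMk_left
  · exact ((hf.comp measurable_subtype_coe).comp (MeasurableEquiv.measurable _)).aemeasurable

lemma gaussSphere (n : ℕ) (hn : 2 ≤ n) : ∃ C > (0:ℝ), ∀ u > (0:ℝ), ∀ x : EE n,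
    ∫ y : SS n, (π / u) ^ ((n:ℝ)/2) * rexp (-π^2 * ‖x - (y : EE n)‖^2 / u) ∂(sg n) ≤ C * u ^ (-(1/2) : ℝ) := by
  refine ⟨rexp (π^2) * 2 ^ ((n:ℝ)/2), by positivity, fun u hu x => ?_⟩
  have hsu : 0 < √u := Real.sqrt_pos.2 hu
  set b : ℝ := π^2 / (2*u) with hb
  have hb0 : 0 < b := by positivity
  have key : ENNReal.ofReal (√u) * ∫⁻ y : SS n, ENNReal.ofReal (rexp (-π^2 * ‖x - (y : EE n)‖^2 / u)) ∂(sg n)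
      ≤ ENNReal.ofReal (rexp (π^2) * (π / b) ^ ((n:ℝ)/2)) := by
    have hint : Integrable (fun z : EE n => rexp (-b * ‖z‖^2)) := by
      have := GaussianFourier.integrable_cexp_neg_mul_sq_norm_add (V := EE n) (b := (b:ℂ)) (by simpa using hb0) 0 0
      refine (this.norm).congr (Filter.Eventually.of_forall fun z => ?_)
      simp [Complex.norm_exp]
      norm_cast
      simp
    calc _ = ∫⁻ y : SS n, (∫⁻ ρ in Set.Ioc (1:ℝ) (1 + √u), ENNReal.ofReal (rexp (-π^2 * ‖x - (y : EE n)‖^2 / u))) ∂(sg n) := by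
          rw [← lintegral_const_mul]
          · simp [mul_comm]
          · fun_prop
      _ ≤ ∫⁻ y : SS n, (∫⁻ ρ in Set.Ioi (0:ℝ), ENNReal.ofReal (ρ ^ (n - 1)) * 
            ENNReal.ofReal (rexp (π^2) * rexp (-b * ‖ρ • (y : EE n) - x‖^2))) ∂(sg n) := by
          refine lintegral_mono fun y => ?_
          refine le_trans ?_ (lintegral_mono_set (fun ρ hρ => lt_trans zero_lt_one hρ.1 : Set.Ioc (1:ℝ) (1 + √u) ⊆ Set.Ioi 0))
          refine setLIntegral_mono' measurableSet_Ioc fun ρ hρ => ?_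
          rw [← ENNReal.ofReal_mul (by have := hρ.1; positivity)]
          refine ENNReal.ofReal_le_ofReal ?_
          refine le_trans ?_ (le_mul_of_one_le_left (by positivity) (one_le_pow₀ hρ.1.le))
          rw [← Real.exp_add]
          refine Real.exp_le_exp.2 ?_
          have h1 : ‖ρ • (y : EE n) - x‖ ≤ √u + ‖x - (y : EE n)‖ := by
            have : ρ • (y : EE n) - x = (ρ - 1) • (y : EE n) - (x - y) := by module
            rw [this]
            refine (norm_sub_le _ _).trans ?_
            gcongr
            rw [norm_smul, Real.norm_of_nonneg (by linarith [hρ.1]), norm_eq_of_mem_sphere y]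
            linarith [hρ.2]
          have h2 : ‖ρ • (y : EE n) - x‖^2 ≤ 2 * u + 2 * ‖x - (y : EE n)‖^2 := by
            have h3 : ‖ρ • (y : EE n) - x‖^2 ≤ (√u + ‖x - (y : EE n)‖)^2 := by gcongr
            nlinarith [Real.sq_sqrt hu.le, sq_nonneg (√u - ‖x - (y : EE n)‖)]
          have h4 : b * ‖ρ • (y : EE n) - x‖^2 ≤ b * (2 * u + 2 * ‖x - (y : EE n)‖^2) := by gcongr
          have h5 : b * (2 * u + 2 * ‖x - (y : EE n)‖^2) = π^2 + π^2 * ‖x - (y : EE n)‖^2 / u := by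
            rw [hb]; field_simp
          have h6 : -π^2 * ‖x - (y : EE n)‖^2 / u = - (π^2 * ‖x - (y : EE n)‖^2 / u) := by ring
          linarith
      _ = ∫⁻ z : EE n, ENNReal.ofReal (rexp (π^2) * rexp (-b * ‖z - x‖^2)) := by
          rw [polar n hn _ (by fun_prop)]
      _ = _ := by
          rw [← ofReal_integral_eq_lintegral_ofReal]
          · rw [integral_const_mul, integral_sub_right_eq_self (fun z : EE n => rexp (-b * ‖z‖^2)),
              GaussianFourier.integral_rexp_neg_mul_sq_norm hb0]
            simp
          · exact (hint.comp_sub_right x).const_mul _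
          · exact Filter.Eventually.of_forall fun z => by positivity
  rw [integral_const_mul]
  have hI : Integrable (fun y : SS n => rexp (-π^2 * ‖x - (y : EE n)‖^2 / u)) (sg n) := 
    Continuous.integrable_of_hasCompactSupport (by fun_prop) (HasCompactSupport.of_compactSpace _)
  rw [← ofReal_integral_eq_lintegral_ofReal hI (Filter.Eventually.of_forall fun z => by positivity),
    ← ENNReal.ofReal_mul hsu.le, ENNReal.ofReal_le_ofReal_iff (by positivity)] at key
  have e1 : π / b = 2 * (u / π) := by rw [hb]; field_simp
  rw [e1, Real.mul_rpow (by positivity) (by positivity)] at key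
  have e2 : (π / u) ^ ((n:ℝ)/2) * (u/π) ^ ((n:ℝ)/2) = 1 := by
    rw [← Real.mul_rpow (by positivity) (by positivity)]
    have : π / u * (u / π) = 1 := by field_simp
    simp [this]
  have e3 : u ^ (-(1/2) : ℝ) = (√u)⁻¹ := by
    rw [Real.rpow_neg hu.le, Real.sqrt_eq_rpow]
  rw [e3, ← div_eq_mul_inv, le_div_iff₀ hsu]
  calc _ = (π / u) ^ ((n:ℝ)/2) * (√u * ∫ y : SS n, rexp (-π^2 * ‖x - (y : EE n)‖^2 / u) ∂(sg n)) := by ring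
    _ ≤ _ := mul_le_mul_of_nonneg_left key (by positivity)
    _ = rexp (π^2) * 2 ^ ((n:ℝ)/2) * ((π / u) ^ ((n:ℝ)/2) * (u/π) ^ ((n:ℝ)/2)) := by ring
    _ = _ := by rw [e2, mul_one]

lemma gaussInt (n : ℕ) {u : ℝ} (hu : 0 < u) : Integrable (fun z : EE n => rexp (-u * ‖z‖^2)) := by
  have := GaussianFourier.integrable_cexp_neg_mul_sq_norm_add (V := EE n) (b := (u:ℂ)) (by simpa using hu) 0 0
  refine (this.norm).congr (Filter.Eventually.of_forall fun z => ?_)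
  simp [Complex.norm_exp]
  norm_cast
  simp

def ch {n : ℕ} (x ξ : EE n) : ℂ := Complex.exp (((2 * π * inner ℝ x ξ : ℝ) : ℂ) * Complex.I)

lemma norm_ch {n : ℕ} (x ξ : EE n) : ‖ch x ξ‖ = 1 := Complex.norm_exp_ofReal_mul_I _

lemma conj_ch {n : ℕ} (x ξ : EE n) : (starRingEnd ℂ) (ch x ξ) = ch (-x) ξ := by
  unfold ch
  rw [← Complex.exp_conj, map_mul, Complex.conj_ofReal, Complex.conj_I, inner_neg_left]
  push_cast
  ring_nf

lemma ch_mul {n : ℕ} (x y ξ : EE n) : ch x ξ * ch y ξ = ch (x + y) ξ := by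
  unfold ch
  rw [← Complex.exp_add, inner_add_left]
  push_cast
  ring_nf

lemma ch_cont {n : ℕ} {X : Type*} [TopologicalSpace X] {f g : X → EE n} (hf : Continuous f) (hg : Continuous g) :
    Continuous (fun x => ch (f x) (g x)) := by
  unfold ch
  fun_prop

def FG {n : ℕ} (g : SS n → ℂ) (ξ : EE n) : ℂ := ∫ y : SS n, ch (-(y : EE n)) ξ * g y ∂(sg n)

lemma intS {n : ℕ} {F : Type*} [NormedAddCommGroup F] {f : SS n → F} (hf : Continuous f) : Integrable f (sg n) :=
  Continuous.integrable_of_hasCompactSupport hf (HasCompactSupport.of_compactSpace _)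

lemma intSS {n : ℕ} {F : Type*} [NormedAddCommGroup F] {f : SS n × SS n → F} (hf : Continuous f) :
    Integrable f ((sg n).prod (sg n)) := by
  obtain ⟨M, hM⟩ := (isCompact_range hf).isBounded.exists_norm_le
  refine Integrable.mono' (integrable_const M) ?_ (Filter.Eventually.of_forall fun q => hM _ ⟨q, rfl⟩)
  exact hf.aestronglyMeasurable

lemma FG_cont {n : ℕ} {g : SS n → ℂ} (hg : Continuous g) : Continuous (FG g) := by
  unfold FG
  refine continuous_of_dominated (bound := fun y => ‖g y‖) ?_ ?_ ?_ ?_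
  · intro ξ
    exact (intS ((ch_cont (by fun_prop) (by fun_prop)).mul hg)).aestronglyMeasurable
  · intro ξ
    exact Filter.Eventually.of_forall fun y => by simp [norm_ch]
  · exact intS hg.norm
  · exact Filter.Eventually.of_forall fun y => (ch_cont (by fun_prop) (by fun_prop)).mul continuous_const

lemma FG_bdd {n : ℕ} {g : SS n → ℂ} (ξ : EE n) : ‖FG g ξ‖ ≤ ∫ y, ‖g y‖ ∂(sg n) := by
  unfold FG
  refine (norm_integral_le_integral_norm _).trans (le_of_eq ?_)
  simp [norm_ch]

lemma gauss_ch (n : ℕ) {u : ℝ} (hu : 0 < u) (x : EE n) :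
    ∫ ξ : EE n, (rexp (-u * ‖ξ‖^2) : ℂ) * ch x ξ = (((π/u) ^ ((n:ℝ)/2) * rexp (-π^2 * ‖x‖^2 / u) : ℝ) : ℂ) := by
  have := GaussianFourier.integral_cexp_neg_mul_sq_norm_add (V := EE n) (b := (u:ℂ)) (by simpa using hu) (2 * π * Complex.I) x
  rw [Complex.ofReal_mul, Complex.ofReal_cpow (by positivity)]
  convert this using 1
  · congr 1
    ext ξ
    unfold ch
    rw [Complex.ofReal_exp, ← Complex.exp_add]
    push_cast
    ring_nf
  · congr 1
    · simp
    · push_cast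
      congr 1
      have : (u:ℂ) ≠ 0 := by exact_mod_cast hu.ne'
      simp [mul_pow]
      field_simp
      try ring

lemma FG_sq {n : ℕ} {g : SS n → ℂ} (ξ : EE n) :
    ((‖FG g ξ‖^2 : ℝ) : ℂ) = ∫ q : SS n × SS n, 
      ch ((q.2 : EE n) - (q.1 : EE n)) ξ * (g q.1 * (starRingEnd ℂ) (g q.2)) ∂((sg n).prod (sg n)) := by
  have h1 : ((‖FG g ξ‖^2 : ℝ) : ℂ) = FG g ξ * (starRingEnd ℂ) (FG g ξ) := by
    rw [Complex.mul_conj']; push_cast; rfl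
  rw [h1]
  unfold FG
  rw [← integral_conj, ← integral_prod_mul]
  congr 1
  ext q
  rw [map_mul, conj_ch, neg_neg, show (q.2 : EE n) - (q.1 : EE n) = -(q.1 : EE n) + (q.2 : EE n) by abel, ← ch_mul]
  ring

lemma lem2 (n : ℕ) (hn : 2 ≤ n) : ∃ C > (0:ℝ), ∀ u > (0:ℝ), ∀ g : SS n → ℂ, Continuous g →
    ∫ ξ : EE n, rexp (-u * ‖ξ‖^2) * ‖FG g ξ‖^2 ≤ C * u ^ (-(1/2) : ℝ) * ∫ y, ‖g y‖^2 ∂(sg n) := by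
  obtain ⟨C, hC, hK⟩ := gaussSphere n hn
  refine ⟨C, hC, fun u hu g hg => ?_⟩
  set K : EE n → ℝ := fun x => (π/u) ^ ((n:ℝ)/2) * rexp (-π^2 * ‖x‖^2 / u) with hKdef
  have hK0 : ∀ x, 0 ≤ K x := fun x => by positivity
  have hKc : Continuous K := by fun_prop
  have hKs : ∀ x y, K (x - y) = K (y - x) := fun x y => by simp only [hKdef, norm_sub_rev]
  have e1 : ((∫ ξ : EE n, rexp (-u * ‖ξ‖^2) * ‖FG g ξ‖^2 : ℝ) : ℂ) = 
      ∫ q : SS n × SS n, (K ((q.2 : EE n) - q.1) : ℂ) * (g q.1 * (starRingEnd ℂ) (g q.2)) ∂((sg n).prod (sg n)) := by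
    rw [← integral_complex_ofReal]
    calc _ = ∫ ξ : EE n, ∫ q : SS n × SS n, (rexp (-u * ‖ξ‖^2) : ℂ) *
      (ch ((q.2 : EE n) - (q.1 : EE n)) ξ * (g q.1 * (starRingEnd ℂ) (g q.2))) ∂((sg n).prod (sg n)) := by
          congr 1
          ext ξ
          rw [Complex.ofReal_mul, FG_sq, integral_const_mul]
      _ = ∫ q : SS n × SS n, (∫ ξ : EE n, (rexp (-u * ‖ξ‖^2) : ℂ) *
      (ch ((q.2 : EE n) - (q.1 : EE n)) ξ * (g q.1 * (starRingEnd ℂ) (g q.2)))) ∂((sg n).prod (sg n)) := by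
          apply integral_integral_swap
          have hb : Integrable (fun z : EE n × (SS n × SS n) => rexp (-u * ‖z.1‖^2) * (‖g z.2.1‖ * ‖g z.2.2‖)) 
            (volume.prod ((sg n).prod (sg n))) := 
            (gaussInt n hu).mul_prod (intSS (f := fun q => ‖g q.1‖ * ‖g q.2‖) (by fun_prop))
          refine hb.mono' ?_ (Filter.Eventually.of_forall fun z => ?_)
          · refine Continuous.aestronglyMeasurable ?_
            refine Continuous.mul (by fun_prop) (Continuous.mul (ch_cont (by fun_prop) (by fun_prop)) ?_)
            have := Complex.continuous_conj
            fun_prop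
          · simp [norm_ch, Function.uncurry, abs_of_pos (Real.exp_pos _), -Complex.ofReal_exp]
            try (norm_cast)
      _ = _ := by
          congr 1
          ext q
          rw [← gauss_ch n hu, ← integral_mul_const]
          congr 1
          ext ξ
          ring
  have hpos : 0 ≤ ∫ ξ : EE n, rexp (-u * ‖ξ‖^2) * ‖FG g ξ‖^2 := integral_nonneg fun ξ => by positivity
  have e2 : ∫ ξ : EE n, rexp (-u * ‖ξ‖^2) * ‖FG g ξ‖^2 ≤ 
      ∫ q : SS n × SS n, K ((q.2 : EE n) - q.1) * (‖g q.1‖ * ‖g q.2‖) ∂((sg n).prod (sg n)) := by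
    rw [← abs_of_nonneg hpos, ← Real.norm_eq_abs, ← Complex.norm_real, e1]
    refine (norm_integral_le_integral_norm _).trans (le_of_eq ?_)
    congr 1
    ext q
    simp [abs_of_nonneg (hK0 _)]
  have e3 : ∫ q : SS n × SS n, K ((q.1 : EE n) - q.2) * ‖g q.1‖^2 ∂((sg n).prod (sg n)) ≤ C * u ^ (-(1/2) : ℝ) * ∫ y, ‖g y‖^2 ∂(sg n) := by
    rw [integral_prod _ (intSS (by fun_prop)), ← integral_const_mul]
    refine integral_mono_of_nonneg (Filter.Eventually.of_forall fun y => integral_nonneg fun z => mul_nonneg (hK0 _) (by positivity)) 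
      (intS (by fun_prop)) (Filter.Eventually.of_forall fun y => ?_)
    simp only
    rw [integral_mul_const]
    exact mul_le_mul_of_nonneg_right (hK u hu y) (by positivity)
  have e4 : ∫ q : SS n × SS n, K ((q.1 : EE n) - q.2) * ‖g q.2‖^2 ∂((sg n).prod (sg n)) = 
      ∫ q : SS n × SS n, K ((q.1 : EE n) - q.2) * ‖g q.1‖^2 ∂((sg n).prod (sg n)) := by
    rw [← integral_prod_swap]
    congr 1
    ext q
    simp only [Prod.fst_swap, Prod.snd_swap]
    rw [hKs]
  refine e2.trans (le_trans ?_ e3)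
  calc _ ≤ ∫ q : SS n × SS n, (1/2) * (K ((q.1 : EE n) - q.2) * ‖g q.1‖^2) + (1/2) * (K ((q.1 : EE n) - q.2) * ‖g q.2‖^2) ∂((sg n).prod (sg n)) := by
        refine integral_mono (intSS (by fun_prop)) (intSS (by fun_prop)) fun q => ?_
        simp only
        rw [hKs]
        have := mul_le_mul_of_nonneg_left (two_mul_le_add_sq ‖g q.1‖ ‖g q.2‖) (hK0 ((q.1 : EE n) - q.2))
        linarith
    _ = _ := by
        rw [integral_add (intSS (by fun_prop)) (intSS (by fun_prop)), integral_const_mul, integral_const_mul, e4]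
        ring

lemma powInt {b T : ℝ} (hb : -1 < b) (hT : 0 < T) :
    ∫⁻ u in Set.Ioc 0 T, ENNReal.ofReal (u ^ b) = ENNReal.ofReal (T ^ (b+1) / (b+1)) := by
  rw [← ofReal_integral_eq_lintegral_ofReal]
  · rw [← intervalIntegral.integral_of_le hT.le, integral_rpow (Or.inl hb), Real.zero_rpow (by linarith), sub_zero]
  · exact (intervalIntegral.intervalIntegrable_rpow' hb).1
  · filter_upwards [ae_restrict_mem measurableSet_Ioc] with u hu
    exact Real.rpow_nonneg hu.1.le _

lemma lem3 (n : ℕ) (hn : 2 ≤ n) (a : ℝ) (ha : 1/2 < a) : ∃ C > (0:ℝ), ∀ A > (0:ℝ), ∀ g : SS n → ℂ, Continuous g →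
    ∫⁻ ξ in {ξ : EE n | A ≤ ‖ξ‖}, ENNReal.ofReal (‖ξ‖ ^ (-(2*a)) * ‖FG g ξ‖^2) ≤
      ENNReal.ofReal (C * A ^ (-(2*a-1)) * ∫ y, ‖g y‖^2 ∂(sg n)) := by
  obtain ⟨C, hC, hK⟩ := lem2 n hn
  have ha' : 0 < a - 1/2 := by linarith
  have ha0 : 0 < a := by linarith
  refine ⟨rexp 1 * a * C / (a - 1/2), by positivity, fun A hA g hg => ?_⟩
  set N := ∫ y, ‖g y‖^2 ∂(sg n) with hN
  have hN0 : 0 ≤ N := integral_nonneg fun y => by positivity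
  have hGc := FG_cont hg
  have pt : ∀ ξ : EE n, A ≤ ‖ξ‖ → ENNReal.ofReal (‖ξ‖ ^ (-(2*a)) * ‖FG g ξ‖^2) ≤
      ENNReal.ofReal (rexp 1 * a) * ∫⁻ u in Set.Ioc 0 (1/A^2), ENNReal.ofReal (u ^ (a-1)) * ENNReal.ofReal (rexp (-u * ‖ξ‖^2) * ‖FG g ξ‖^2) := by
    intro ξ hξ
    have hξ0 : 0 < ‖ξ‖ := lt_of_lt_of_le hA hξ
    have h1 : ∫⁻ u in Set.Ioc 0 (1/‖ξ‖^2), ENNReal.ofReal (u ^ (a-1)) * ENNReal.ofReal (rexp (-1) * ‖FG g ξ‖^2) ≤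
        ∫⁻ u in Set.Ioc 0 (1/A^2), ENNReal.ofReal (u ^ (a-1)) * ENNReal.ofReal (rexp (-u * ‖ξ‖^2) * ‖FG g ξ‖^2) := by
      have hsub : Set.Ioc 0 (1/‖ξ‖^2) ⊆ Set.Ioc 0 (1/A^2) := Set.Ioc_subset_Ioc_right (by gcongr)
      refine le_trans ?_ (lintegral_mono_set hsub)
      refine setLIntegral_mono' measurableSet_Ioc fun u hu => ?_
      gcongr
      have := hu.2
      rw [le_div_iff₀ (by positivity)] at this
      linarith
    refine le_trans ?_ (mul_le_mul_right h1 _)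
    rw [lintegral_mul_const _ (by fun_prop), powInt (by linarith) (by positivity), ← ENNReal.ofReal_mul (by rw [sub_add_cancel]; positivity),
      ← ENNReal.ofReal_mul (by positivity)]
    refine ENNReal.ofReal_le_ofReal (le_of_eq ?_)
    have e : (1 / ‖ξ‖^2) ^ (a - 1 + 1) = ‖ξ‖ ^ (-(2*a)) := by
      rw [sub_add_cancel, one_div, Real.inv_rpow (by positivity), ← Real.rpow_natCast, ← Real.rpow_mul hξ0.le, Real.rpow_neg hξ0.le]
      norm_num
    rw [e, sub_add_cancel, Real.exp_neg]
    have := Real.exp_pos 1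
    field_simp
  calc _ ≤ ∫⁻ ξ in {ξ : EE n | A ≤ ‖ξ‖}, ENNReal.ofReal (rexp 1 * a) * ∫⁻ u in Set.Ioc 0 (1/A^2), ENNReal.ofReal (u ^ (a-1)) * ENNReal.ofReal (rexp (-u * ‖ξ‖^2) * ‖FG g ξ‖^2) :=
        setLIntegral_mono' (measurableSet_le measurable_const measurable_norm) pt
    _ ≤ ∫⁻ ξ : EE n, ENNReal.ofReal (rexp 1 * a) * ∫⁻ u in Set.Ioc 0 (1/A^2), ENNReal.ofReal (u ^ (a-1)) * ENNReal.ofReal (rexp (-u * ‖ξ‖^2) * ‖FG g ξ‖^2) :=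
        setLIntegral_le_lintegral _ _
    _ = ENNReal.ofReal (rexp 1 * a) * ∫⁻ u in Set.Ioc 0 (1/A^2), ∫⁻ ξ : EE n, ENNReal.ofReal (u ^ (a-1)) * ENNReal.ofReal (rexp (-u * ‖ξ‖^2) * ‖FG g ξ‖^2) := by
        rw [lintegral_const_mul' _ _ ENNReal.ofReal_ne_top, lintegral_lintegral_swap]
        refine Measurable.aemeasurable ?_
        simp only [Function.uncurry_def]
        have := hGc.measurable
        fun_prop
    _ ≤ ENNReal.ofReal (rexp 1 * a) * ∫⁻ u in Set.Ioc 0 (1/A^2), ENNReal.ofReal (u ^ (a - 3/2)) * ENNReal.ofReal (C * N) := by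
        refine mul_le_mul_right ?_ _
        refine setLIntegral_mono' measurableSet_Ioc fun u hu => ?_
        have hu0 := hu.1
        rw [lintegral_const_mul' _ _ ENNReal.ofReal_ne_top, ← ofReal_integral_eq_lintegral_ofReal,
          ← ENNReal.ofReal_mul (by positivity), ← ENNReal.ofReal_mul (by positivity)]
        · refine ENNReal.ofReal_le_ofReal ?_
          refine (mul_le_mul_of_nonneg_left (hK u hu0 g hg) (by positivity)).trans (le_of_eq ?_)
          rw [show a - 3/2 = (a-1) + (-(1/2)) by ring, Real.rpow_add hu0]
          ring
        · refine Integrable.mono' ((gaussInt n hu0).mul_const ((∫ y, ‖g y‖ ∂(sg n))^2)) ?_ (Filter.Eventually.of_forall fun ξ => ?_)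
          · exact Continuous.aestronglyMeasurable (by fun_prop)
          · rw [Real.norm_of_nonneg (by positivity)]
            gcongr
            exact FG_bdd ξ
        · exact Filter.Eventually.of_forall fun ξ => by positivity
    _ = _ := by
        rw [lintegral_mul_const _ (by fun_prop), powInt (by linarith) (by positivity), ← ENNReal.ofReal_mul, ← ENNReal.ofReal_mul (by positivity)]
        · congr 1
          have e : (1 / A^2) ^ (a - 3/2 + 1) = A ^ (-(2*a-1)) := by
            rw [one_div, Real.inv_rpow (by positivity), ← Real.rpow_natCast, ← Real.rpow_mul hA.le, Real.rpow_neg hA.le]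
            congr 2
            push_cast
            ring
          rw [e, show a - 3/2 + 1 = a - 1/2 by ring]
          field_simp
        · rw [show a - 3/2 + 1 = a - 1/2 by ring]
          positivity

def WW {n : ℕ} (h : EE n → ℂ) (x : EE n) : ℂ := ∫ ξ, ch x ξ * h ξ

lemma WW_cont {n : ℕ} {h : EE n → ℂ} (hh : Integrable h) : Continuous (WW h) := by
  unfold WW
  refine continuous_of_dominated (bound := fun y => ‖h y‖) ?_ ?_ hh.norm ?_
  · intro x
    exact (ch_cont (by fun_prop) (by fun_prop)).aestronglyMeasurable.mul hh.aestronglyMeasurable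
  · intro ξ
    exact Filter.Eventually.of_forall fun y => by simp [norm_ch]
  · exact Filter.Eventually.of_forall fun y => (ch_cont (by fun_prop) (by fun_prop)).mul continuous_const

lemma lem4 (n : ℕ) (hn : 2 ≤ n) (a : ℝ) (ha : 1/2 < a) : ∃ C > (0:ℝ), ∀ A > (0:ℝ), ∀ h : EE n → ℂ, Measurable h → Integrable h →
    (∀ ξ, ‖ξ‖ < A → h ξ = 0) →
    ENNReal.ofReal (∫ y : SS n, ‖WW h y‖^2 ∂(sg n)) ≤ 
     ENNReal.ofReal (C * A ^ (-(2*a-1))) * ∫⁻ ξ, ENNReal.ofReal (‖ξ‖ ^ (2*a) * ‖h ξ‖^2) := by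
  obtain ⟨C, hC, hG⟩ := lem3 n hn a ha
  refine ⟨C, hC, fun A hA h hm hh h0 => ?_⟩
  have hw := WW_cont hh
  set g : SS n → ℂ := fun y => WW h y with hg
  have hgc : Continuous g := by fun_prop
  have hGc := FG_cont hgc
  set X := ∫ y : SS n, ‖WW h y‖^2 ∂(sg n) with hX
  have hX0 : 0 ≤ X := integral_nonneg fun y => by positivity
  set K := C * A ^ (-(2*a-1)) with hK
  have hK0 : 0 < K := by positivity
  have e1 : (X : ℂ) = ∫ ξ, h ξ * (starRingEnd ℂ) (FG g ξ) := by
    rw [hX, ← integral_complex_ofReal]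
    calc _ = ∫ y : SS n, (∫ ξ : EE n, ch (y : EE n) ξ * h ξ * (starRingEnd ℂ) (g y)) ∂(sg n) := by
          congr 1
          ext y
          rw [integral_mul_const]
          change _ = WW h y * _
          rw [hg, Complex.mul_conj']
          push_cast
          rfl
      _ = ∫ ξ : EE n, (∫ y : SS n, ch (y : EE n) ξ * h ξ * (starRingEnd ℂ) (g y) ∂(sg n)) := by
          apply integral_integral_swap
          have hb : Integrable (fun z : SS n × EE n => ‖g z.1‖ * ‖h z.2‖) ((sg n).prod volume) :=
            (intS hgc.norm).mul_prod hh.norm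
          refine hb.mono' ?_ (Filter.Eventually.of_forall fun z => ?_)
          · have h1 : Continuous fun z : SS n × EE n => ch (z.1 : EE n) z.2 := ch_cont (by fun_prop) (by fun_prop)
            have h2 : Continuous fun z : SS n × EE n => (starRingEnd ℂ) (g z.1) := Complex.continuous_conj.comp (by fun_prop)
            exact ((h1.measurable.mul (hm.comp measurable_snd)).mul h2.measurable).aestronglyMeasurable
          · simp [norm_ch, Function.uncurry, mul_comm]
      _ = _ := by
          congr 1
          ext ξ
          unfold FG
          rw [← integral_conj, ← integral_const_mul]
          congr 1
          ext y
          rw [map_mul, conj_ch, neg_neg]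
          ring
  set H := ∫⁻ ξ, ENNReal.ofReal (‖ξ‖ ^ (2*a) * ‖h ξ‖^2) with hH
  have e2 : ENNReal.ofReal X ≤ ENNReal.ofReal (K/2) * H + ENNReal.ofReal (X/2) := by
    have e3 : ENNReal.ofReal X = ‖(X:ℂ)‖ₑ := by
      rw [← ofReal_norm, Complex.norm_real, Real.norm_of_nonneg hX0]
    have hms : MeasurableSet {ξ : EE n | A ≤ ‖ξ‖} := measurableSet_le measurable_const measurable_norm
    rw [e3, e1]
    refine (enorm_integral_le_lintegral_enorm _).trans ?_
    calc _ ≤ ∫⁻ ξ, (ENNReal.ofReal (K/2) * ENNReal.ofReal (‖ξ‖ ^ (2*a) * ‖h ξ‖^2) + 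
            Set.indicator {ξ : EE n | A ≤ ‖ξ‖} (fun ξ => ENNReal.ofReal (1/(2*K)) * ENNReal.ofReal (‖ξ‖ ^ (-(2*a)) * ‖FG g ξ‖^2)) ξ) := by
          refine lintegral_mono fun ξ => ?_
          by_cases hξ : A ≤ ‖ξ‖
          · have hξ0 : 0 < ‖ξ‖ := lt_of_lt_of_le hA hξ
            rw [Set.indicator_of_mem (show ξ ∈ {ξ : EE n | A ≤ ‖ξ‖} from hξ), ← ENNReal.ofReal_mul (by positivity), ← ENNReal.ofReal_mul (by positivity),
              ← ENNReal.ofReal_add (by positivity) (by positivity), ← ofReal_norm]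
            refine ENNReal.ofReal_le_ofReal ?_
            rw [norm_mul, RCLike.norm_conj, Real.rpow_neg hξ0.le]
            set t := ‖ξ‖ ^ (2*a) with ht
            have ht0 : 0 < t := by positivity
            have key : K/2 * (t * ‖h ξ‖^2) + 1/(2*K) * (t⁻¹ * ‖FG g ξ‖^2) - ‖h ξ‖ * ‖FG g ξ‖ = (K * t * ‖h ξ‖ - ‖FG g ξ‖)^2/(2*K*t) := by
              field_simp
              ring
            have : 0 ≤ (K * t * ‖h ξ‖ - ‖FG g ξ‖)^2/(2*K*t) := by positivity
            linarith
          · rw [h0 ξ (not_le.1 hξ)]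
            simp
      _ = ENNReal.ofReal (K/2) * H + ENNReal.ofReal (1/(2*K)) * ∫⁻ ξ in {ξ : EE n | A ≤ ‖ξ‖}, ENNReal.ofReal (‖ξ‖ ^ (-(2*a)) * ‖FG g ξ‖^2) := by
          rw [lintegral_add_left (by fun_prop), lintegral_const_mul' _ _ ENNReal.ofReal_ne_top, lintegral_indicator hms,
            lintegral_const_mul' _ _ ENNReal.ofReal_ne_top]
      _ ≤ _ := by
          refine add_le_add_right ?_ _
          refine (mul_le_mul_right (hG A hA g hgc) _).trans ?_
          rw [← ENNReal.ofReal_mul (by positivity)]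
          refine ENNReal.ofReal_le_ofReal (le_of_eq ?_)
          change 1 / (2*K) * (K * X) = X/2
          field_simp
  have e4 : ENNReal.ofReal X = ENNReal.ofReal (X/2) + ENNReal.ofReal (X/2) := by
    rw [← ENNReal.ofReal_add (by positivity) (by positivity)]; ring_nf
  rw [e4] at e2
  have e5 := (ENNReal.add_le_add_iff_right ENNReal.ofReal_ne_top).1 e2
  have e6 : ENNReal.ofReal K = ENNReal.ofReal (K/2) + ENNReal.ofReal (K/2) := by
    rw [← ENNReal.ofReal_add (by positivity) (by positivity)]; ring_nf
  rw [e4, e6, add_mul]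
  exact add_le_add e5 e5

lemma lowInt (n : ℕ) (hn : 2 ≤ n) (s : ℝ) (hs : s < n/2) : ∃ c > (0:ℝ), ∀ A > (0:ℝ), 
    ∫⁻ ξ in {ξ : EE n | ‖ξ‖ < A}, ENNReal.ofReal (‖ξ‖ ^ (-(2*s))) ≤ ENNReal.ofReal (c * A ^ ((n:ℝ) - 2*s)) := by
  have hns : 0 < (n:ℝ) - 2*s := by linarith
  have hM : (0:ℝ) ≤ (sg n).real Set.univ := measureReal_nonneg
  refine ⟨((sg n).real Set.univ + 1) / ((n:ℝ) - 2*s), by positivity, fun A hA => ?_⟩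
  have hms : MeasurableSet {ξ : EE n | ‖ξ‖ < A} := measurableSet_lt measurable_norm measurable_const
  rw [← lintegral_indicator hms, polar n hn _ (Measurable.indicator (by fun_prop) hms)]
  calc _ ≤ ∫⁻ y : SS n, ENNReal.ofReal (A ^ ((n:ℝ) - 2*s) / ((n:ℝ) - 2*s)) ∂(sg n) := by
        refine lintegral_mono fun y => ?_
        have h1 := powInt (b := (n:ℝ) - 1 - 2*s) (T := A) (by linarith) hA
        rw [show (n:ℝ) - 1 - 2*s + 1 = n - 2*s by ring] at h1
        rw [← h1, ← lintegral_indicator measurableSet_Ioi, ← lintegral_indicator measurableSet_Ioc]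
        refine lintegral_mono fun ρ => ?_
        by_cases hρ : 0 < ρ
        · rw [Set.indicator_of_mem (show ρ ∈ Set.Ioi 0 from hρ)]
          have hnorm : ‖ρ • (y : EE n)‖ = ρ := by
            rw [norm_smul, Real.norm_of_nonneg hρ.le, norm_eq_of_mem_sphere y, mul_one]
          by_cases hρA : ρ < A
          · rw [Set.indicator_of_mem (by simpa [hnorm] using hρA), Set.indicator_of_mem (show ρ ∈ Set.Ioc 0 A from ⟨hρ, hρA.le⟩), hnorm,
              ← ENNReal.ofReal_mul (by positivity)]
            refine ENNReal.ofReal_le_ofReal (le_of_eq ?_)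
            rw [← Real.rpow_natCast, ← Real.rpow_add hρ, Nat.cast_sub (by omega)]
            congr 1
            push_cast
            ring
          · rw [Set.indicator_of_notMem (by simpa [hnorm] using hρA)]
            simp
        · rw [Set.indicator_of_notMem (show ρ ∉ Set.Ioi 0 from hρ)]
          simp
    _ = ENNReal.ofReal (A ^ ((n:ℝ) - 2*s) / ((n:ℝ) - 2*s)) * ENNReal.ofReal ((sg n).real Set.univ) := by
        rw [lintegral_const, ofReal_measureReal]
    _ ≤ _ := by
        rw [← ENNReal.ofReal_mul (by positivity)]
        refine ENNReal.ofReal_le_ofReal ?_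
        have : A ^ ((n:ℝ) - 2*s) / ((n:ℝ) - 2*s) * (sg n).real Set.univ ≤ A ^ ((n:ℝ) - 2*s) / ((n:ℝ) - 2*s) * ((sg n).real Set.univ + 1) := by
          gcongr; linarith
        refine this.trans (le_of_eq (by ring))

lemma lem_low (n : ℕ) (hn : 2 ≤ n) (s : ℝ) (hs : s < n/2) : ∃ c > (0:ℝ), ∀ A > (0:ℝ), ∀ h : EE n → ℂ, Measurable h → Integrable h →
    ∫⁻ ξ, ENNReal.ofReal (‖ξ‖ ^ (2*s) * ‖h ξ‖^2) ≤ 1 → 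
    ∀ x, ‖WW (Set.indicator {ξ : EE n | ‖ξ‖ < A} h) x‖ ≤ c * A ^ ((n:ℝ)/2 - s) := by
  obtain ⟨c, hc, hI⟩ := lowInt n hn s hs
  refine ⟨(1+c)/2, by positivity, fun A hA h hm hh hH x => ?_⟩
  have : Nonempty (Fin n) := ⟨⟨0, by omega⟩⟩
  have : Nontrivial (EE n) := inferInstance
  have hms : MeasurableSet {ξ : EE n | ‖ξ‖ < A} := measurableSet_lt measurable_norm measurable_const
  set B := A ^ ((n:ℝ)/2 - s) with hB
  have hB0 : 0 < B := by positivity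
  rw [← ENNReal.ofReal_le_ofReal_iff (by positivity)]
  unfold WW
  rw [ofReal_norm]
  refine (enorm_integral_le_lintegral_enorm _).trans ?_
  have hne : ∀ᵐ ξ : EE n, ξ ≠ 0 := compl_mem_ae_iff.2 (measure_singleton 0)
  calc _ ≤ ∫⁻ ξ, (ENNReal.ofReal (B/2) * ENNReal.ofReal (‖ξ‖ ^ (2*s) * ‖h ξ‖^2) + 
            Set.indicator {ξ : EE n | ‖ξ‖ < A} (fun ξ => ENNReal.ofReal (1/(2*B)) * ENNReal.ofReal (‖ξ‖ ^ (-(2*s)))) ξ) := by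
        refine lintegral_mono_ae ?_
        filter_upwards [hne] with ξ hξ0
        have hξ0 : 0 < ‖ξ‖ := norm_pos_iff.2 hξ0
        by_cases hξ : ‖ξ‖ < A
        · rw [Set.indicator_of_mem (show ξ ∈ {ξ : EE n | ‖ξ‖ < A} from hξ), Set.indicator_of_mem (show ξ ∈ {ξ : EE n | ‖ξ‖ < A} from hξ), 
            ← ENNReal.ofReal_mul (by positivity), ← ENNReal.ofReal_mul (by positivity),
            ← ENNReal.ofReal_add (by positivity) (by positivity), ← ofReal_norm]
          refine ENNReal.ofReal_le_ofReal ?_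
          rw [norm_mul, norm_ch, one_mul, Real.rpow_neg hξ0.le]
          set t := ‖ξ‖ ^ (2*s) with ht
          have ht0 : 0 < t := by positivity
          have key : B/2 * (t * ‖h ξ‖^2) + 1/(2*B) * t⁻¹ - ‖h ξ‖ = (B * t * ‖h ξ‖ - 1)^2/(2*B*t) := by
            field_simp
            ring
          have : 0 ≤ (B * t * ‖h ξ‖ - 1)^2/(2*B*t) := by positivity
          linarith
        · rw [Set.indicator_of_notMem (show ξ ∉ {ξ : EE n | ‖ξ‖ < A} from hξ)]
          simp
    _ = ENNReal.ofReal (B/2) * (∫⁻ ξ, ENNReal.ofReal (‖ξ‖ ^ (2*s) * ‖h ξ‖^2)) + ENNReal.ofReal (1/(2*B)) * ∫⁻ ξ in {ξ : EE n | ‖ξ‖ < A}, ENNReal.ofReal (‖ξ‖ ^ (-(2*s))) := by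
        rw [lintegral_add_left (by fun_prop), lintegral_const_mul' _ _ ENNReal.ofReal_ne_top, lintegral_indicator hms,
            lintegral_const_mul' _ _ ENNReal.ofReal_ne_top]
    _ ≤ ENNReal.ofReal (B/2) * 1 + ENNReal.ofReal (1/(2*B)) * ENNReal.ofReal (c * A ^ ((n:ℝ) - 2*s)) := by
        gcongr
        exact hI A hA
    _ = _ := by
        rw [mul_one, ← ENNReal.ofReal_mul (by positivity), ← ENNReal.ofReal_add (by positivity) (by positivity)]
        congr 1
        have : A ^ ((n:ℝ) - 2*s) = B * B := by
          rw [hB, ← Real.rpow_add hA]; ring_nf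
        rw [this]
        field_simp

lemma lem5 (n : ℕ) (hn : 2 ≤ n) (s : ℝ) (hs1 : 1/2 < s) (hs : s < n/2) (p : ℝ) (hp : ((n : ℝ) - 1) / p = (n : ℝ) / 2 - s) : 
    ∃ C > (0:ℝ), ∀ h : EE n → ℂ, Measurable h → Integrable h →
    ∫⁻ ξ, ENNReal.ofReal (‖ξ‖ ^ (2*s) * ‖h ξ‖^2) ≤ 1 → 
    ∫⁻ y : SS n, ENNReal.ofReal (‖WW h y‖ ^ p) ∂(sg n) ≤ ENNReal.ofReal C := by
  set α := (n:ℝ)/2 - s with hα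
  have hα0 : 0 < α := by linarith
  have hp0 : p ≠ 0 := by
    rintro rfl
    simp at hp
    linarith
  have hpα : (n:ℝ) - 1 = α * p := by field_simp at hp; linarith
  have hppos : 0 < p := by
    have : (2:ℝ) ≤ n := by exact_mod_cast hn
    by_contra hneg
    push Not at hneg
    nlinarith
  set a := (s + 1/2)/2 with ha_def
  have ha : 1/2 < a := by rw [ha_def]; linarith
  have has : a < s := by rw [ha_def]; linarith
  obtain ⟨c0, hc0, hlow⟩ := lem_low n hn s hs
  obtain ⟨C1, hC1, hhigh⟩ := lem4 n hn a ha
  set β := p - 3 - (2*a-1)/α with hβ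
  have hαβ : α * (β + 1) = 2*s - 2*a := by
    rw [hβ]
    field_simp
    linarith
  have hβ1 : 0 < β + 1 := by
    by_contra hneg
    push Not at hneg
    nlinarith
  set D := 4 * C1 * (2*c0) ^ ((2*a-1)/α) with hD
  have hD0 : 0 < D := by positivity
  set D' := D * ((2*c0)^(β+1) / (β+1)) with hD'
  have hD'0 : 0 < D' := by positivity
  refine ⟨p * D', by positivity, fun h hm hh hH => ?_⟩
  have : Nonempty (Fin n) := ⟨⟨0, by omega⟩⟩
  have : Nontrivial (EE n) := inferInstance
  have hne : ∀ᵐ ξ : EE n, ξ ≠ 0 := compl_mem_ae_iff.2 (measure_singleton 0)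
  have hwc := WW_cont hh
  have hwm : Measurable (fun y : SS n => ‖WW h y‖) := (by fun_prop : Continuous (fun y : SS n => ‖WW h y‖)).measurable
  rw [lintegral_rpow_eq_lintegral_meas_lt_mul _ (Filter.Eventually.of_forall fun y => norm_nonneg _) hwm.aemeasurable hppos]
  set Φ : ℝ × EE n → ENNReal := Set.indicator {z : ℝ × EE n | z.1 ≤ 2 * c0 * ‖z.2‖ ^ α} 
    (fun z => ENNReal.ofReal (D * z.1 ^ β) * ENNReal.ofReal (‖z.2‖ ^ (2*a) * ‖h z.2‖^2)) with hΦ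
  have hΦm : Measurable Φ := by
    refine Measurable.indicator (by fun_prop) (measurableSet_le (by fun_prop) (by fun_prop))
  have P1 : ∀ t > (0:ℝ), (sg n) {y : SS n | t < ‖WW h y‖} * ENNReal.ofReal (t ^ (p-1)) ≤ ∫⁻ ξ, Φ (t, ξ) := by
    intro t ht
    set A := (t / (2*c0)) ^ (1/α) with hA
    have hA0 : 0 < A := by positivity
    have hAα : A ^ α = t / (2*c0) := by
      rw [hA, ← Real.rpow_mul (by positivity), one_div_mul_cancel hα0.ne', Real.rpow_one]
    have hmlow : MeasurableSet {ξ : EE n | ‖ξ‖ < A} := measurableSet_lt measurable_norm measurable_const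
    set hl := Set.indicator {ξ : EE n | ‖ξ‖ < A} h with hhl
    set hg := Set.indicator {ξ : EE n | ‖ξ‖ < A}ᶜ h with hhg
    have il : Integrable hl := hh.indicator hmlow
    have ig : Integrable hg := hh.indicator hmlow.compl
    have mg : Measurable hg := hm.indicator hmlow.compl
    have hsum : ∀ x, WW h x = WW hl x + WW hg x := by
      intro x
      unfold WW
      have hb : ∀ {k : EE n → ℂ}, Integrable k → Integrable (fun ξ => ch x ξ * k ξ) := by
        intro k hk
        refine hk.norm.mono' ((ch_cont (by fun_prop) (by fun_prop)).aestronglyMeasurable.mul hk.aestronglyMeasurable) 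
          (Filter.Eventually.of_forall fun ξ => by simp [norm_ch])
      rw [← integral_add (hb il) (hb ig)]
      congr 1
      ext ξ
      rw [← mul_add, hhl, hhg, Set.indicator_self_add_compl_apply]
    have hlb : ∀ x, ‖WW hl x‖ ≤ t/2 := by
      intro x
      refine (hlow A hA0 h hm hh hH x).trans (le_of_eq ?_)
      rw [hAα]
      field_simp
    have hgc := WW_cont ig
    have hgm : Measurable (fun y : SS n => ENNReal.ofReal (‖WW hg y‖^2)) := 
      (by fun_prop : Continuous (fun y : SS n => ‖WW hg y‖^2)).measurable.ennreal_ofReal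
    have hmeas : (sg n) {y : SS n | t < ‖WW h y‖} ≤ ENNReal.ofReal (4 / t^2) * ENNReal.ofReal (∫ y : SS n, ‖WW hg y‖^2 ∂(sg n)) := by
      have h1 : {y : SS n | t < ‖WW h y‖} ⊆ {y : SS n | ENNReal.ofReal (t^2/4) ≤ ENNReal.ofReal (‖WW hg y‖^2)} := by
        intro y hy
        simp only [Set.mem_ofPred_eq] at hy ⊢
        refine ENNReal.ofReal_le_ofReal ?_
        rw [hsum] at hy
        have h2 := norm_add_le (WW hl y) (WW hg y)
        have h3 := hlb y
        have h4 : t/2 ≤ ‖WW hg y‖ := by linarith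
        nlinarith
      refine (measure_mono h1).trans ?_
      refine (meas_ge_le_lintegral_div hgm.aemeasurable (by simpa using (by positivity : 0 < t^2/4)) ENNReal.ofReal_ne_top).trans ?_
      rw [← ofReal_integral_eq_lintegral_ofReal (intS (by fun_prop)) (Filter.Eventually.of_forall fun y => by positivity),
        ENNReal.div_eq_inv_mul, ← ENNReal.ofReal_inv_of_pos (by positivity), inv_div]
    have hkey := hhigh A hA0 hg mg ig (fun ξ hξ => by rw [hhg]; simp [hξ])
    calc _ ≤ ENNReal.ofReal (4 / t^2) * (ENNReal.ofReal (C1 * A ^ (-(2*a-1))) * ∫⁻ ξ, ENNReal.ofReal (‖ξ‖ ^ (2*a) * ‖hg ξ‖^2)) * ENNReal.ofReal (t ^ (p-1)) := by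
          gcongr
          exact hmeas.trans (by gcongr)
      _ = ENNReal.ofReal (D * t^β) * ∫⁻ ξ, ENNReal.ofReal (‖ξ‖ ^ (2*a) * ‖hg ξ‖^2) := by
          have : ENNReal.ofReal (D * t^β) = ENNReal.ofReal (4 / t^2) * ENNReal.ofReal (C1 * A ^ (-(2*a-1))) * ENNReal.ofReal (t ^ (p-1)) := by
            rw [← ENNReal.ofReal_mul (by positivity), ← ENNReal.ofReal_mul (by positivity)]
            congr 1
            have e1 : A ^ (-(2*a-1)) = t ^ (-((2*a-1)/α)) * (2*c0) ^ ((2*a-1)/α) := by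
              rw [hA, ← Real.rpow_mul (by positivity), Real.div_rpow ht.le (by positivity), div_eq_mul_inv, ← Real.rpow_neg (by positivity : 0 ≤ 2*c0)]
              congr 2 <;> ring
            have e2 : t ^ β = t ^ (p-1) * (t^2)⁻¹ * t ^ (-((2*a-1)/α)) := by
              rw [← Real.rpow_natCast, ← Real.rpow_neg ht.le, ← Real.rpow_add ht, ← Real.rpow_add ht, hβ]
              congr 1
              push_cast
              ring
            rw [e1, e2, hD]
            field_simp
          rw [this]
          ring
      _ = ∫⁻ ξ, ENNReal.ofReal (D * t^β) * ENNReal.ofReal (‖ξ‖ ^ (2*a) * ‖hg ξ‖^2) := by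
          rw [lintegral_const_mul' _ _ ENNReal.ofReal_ne_top]
      _ ≤ _ := by
          refine lintegral_mono fun ξ => ?_
          by_cases hξ : ‖ξ‖ < A
          · have : hg ξ = 0 := by rw [hhg]; simp [hξ]
            simp [this]
          · have e3 : hg ξ = h ξ := by rw [hhg]; simp [hξ]
            rw [hΦ, Set.indicator_of_mem]
            · simp only [e3]; exact le_rfl
            · simp only [Set.mem_ofPred_eq]
              have := Real.rpow_le_rpow hA0.le (not_lt.1 hξ) hα0.le
              rw [hAα, div_le_iff₀ (by positivity)] at this
              linarith
  have P2 : ∀ ξ : EE n, ξ ≠ 0 → ∫⁻ t in Set.Ioi (0:ℝ), Φ (t, ξ) ≤ ENNReal.ofReal D' * ENNReal.ofReal (‖ξ‖ ^ (2*s) * ‖h ξ‖^2) := by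
    intro ξ hξ
    have hξ0 : 0 < ‖ξ‖ := norm_pos_iff.2 hξ
    set T := 2 * c0 * ‖ξ‖ ^ α with hT
    have hT0 : 0 < T := by positivity
    calc _ ≤ ∫⁻ t in Set.Ioc 0 T, ENNReal.ofReal (t ^ β) * (ENNReal.ofReal D * ENNReal.ofReal (‖ξ‖ ^ (2*a) * ‖h ξ‖^2)) := by
          rw [← lintegral_indicator measurableSet_Ioi, ← lintegral_indicator measurableSet_Ioc]
          refine lintegral_mono fun t => ?_
          by_cases ht : 0 < t
          · rw [Set.indicator_of_mem (show t ∈ Set.Ioi 0 from ht), hΦ]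
            by_cases htT : t ≤ T
            · rw [Set.indicator_of_mem (show (t, ξ) ∈ {z : ℝ × EE n | z.1 ≤ 2 * c0 * ‖z.2‖ ^ α} from htT), 
                Set.indicator_of_mem (show t ∈ Set.Ioc 0 T from ⟨ht, htT⟩), ENNReal.ofReal_mul hD0.le]
              refine le_of_eq (by ring)
            · rw [Set.indicator_of_notMem (show (t, ξ) ∉ {z : ℝ × EE n | z.1 ≤ 2 * c0 * ‖z.2‖ ^ α} from htT)]
              simp
          · rw [Set.indicator_of_notMem (show t ∉ Set.Ioi 0 from ht)]
            simp
      _ = _ := by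
          rw [lintegral_mul_const _ (by fun_prop), powInt (by linarith) hT0, ← ENNReal.ofReal_mul (by positivity), ← ENNReal.ofReal_mul (by positivity),
            ← ENNReal.ofReal_mul (by positivity)]
          congr 1
          rw [hT, hD', Real.mul_rpow (by positivity) (by positivity), ← Real.rpow_mul hξ0.le, hαβ,
            show 2*s = (2*s-2*a) + 2*a by ring, Real.rpow_add hξ0]
          ring_nf
  rw [ENNReal.ofReal_mul hppos.le]
  refine mul_le_mul_right ?_ _
  calc _ ≤ ∫⁻ t in Set.Ioi (0:ℝ), ∫⁻ ξ, Φ (t, ξ) := setLIntegral_mono' measurableSet_Ioi P1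
    _ = ∫⁻ ξ, ∫⁻ t in Set.Ioi (0:ℝ), Φ (t, ξ) := lintegral_lintegral_swap hΦm.aemeasurable
    _ ≤ ∫⁻ ξ, ENNReal.ofReal D' * ENNReal.ofReal (‖ξ‖ ^ (2*s) * ‖h ξ‖^2) := by
        refine lintegral_mono_ae ?_
        filter_upwards [hne] with ξ hξ using P2 ξ hξ
    _ ≤ ENNReal.ofReal D' * 1 := by
        rw [lintegral_const_mul' _ _ ENNReal.ofReal_ne_top]
        gcongr
    _ = _ := mul_one _

lemma schwartz_int (n : ℕ) (s : ℝ) (hs : 0 < s) (F : SchwartzMap (EE n) ℂ) :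
    Integrable (fun ξ : EE n => ‖ξ‖ ^ (2*s) * ‖F ξ‖^2) := by
  obtain ⟨M, hM⟩ : ∃ M, ∀ ξ, ‖F ξ‖ ≤ M := by
    obtain ⟨M, hM⟩ := F.decay 0 0
    exact ⟨M, fun ξ => by simpa using hM.2 ξ⟩
  have hM0 : 0 ≤ M := (norm_nonneg _).trans (hM 0)
  have hi := ((F.integrable.norm).add (F.integrable_pow_mul volume ⌈2*s⌉₊)).const_mul M
  refine hi.mono' ?_ (Filter.Eventually.of_forall fun ξ => ?_)
  · have := F.continuous
    refine Continuous.aestronglyMeasurable ?_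
    refine Continuous.mul (Continuous.rpow_const continuous_norm fun x => Or.inr (by linarith)) (by fun_prop)
  · rw [Real.norm_of_nonneg (by positivity)]
    simp only [Pi.add_apply]
    have h1 : ‖ξ‖ ^ (2*s) ≤ 1 + ‖ξ‖ ^ ⌈2*s⌉₊ := by
      rcases le_total ‖ξ‖ 1 with h | h
      · have := Real.rpow_le_one (norm_nonneg ξ) h (by linarith : 0 ≤ 2*s)
        have : 0 ≤ ‖ξ‖ ^ ⌈2*s⌉₊ := by positivity
        linarith
      · have := Real.rpow_le_rpow_of_exponent_le h (Nat.le_ceil (2*s))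
        rw [Real.rpow_natCast] at this
        linarith
    calc ‖ξ‖ ^ (2*s) * ‖F ξ‖^2 ≤ (1 + ‖ξ‖ ^ ⌈2*s⌉₊) * (M * ‖F ξ‖) := by
          rw [sq]
          gcongr
          exact hM ξ
      _ = _ := by ring

/-- **Lemma 2.5 (trace-type inequality).** For `n ≥ 2`, `1/2 < s < n/2` and
`(n-1)/p = n/2 - s`, one has `r^{n/2-s} ‖v(r·)‖_{L^p(S^{n-1})} ≤ C ‖v‖_{Ḣ^s(ℝⁿ)}`
for rapidly decaying (e.g. Schwartz) functions `v`. -/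
theorem stmt9_trace_type_inequality
    (n : ℕ) (hn : 2 ≤ n) (s : ℝ) (hs1 : 1 / 2 < s) (hs2 : s < n / 2)
    (p : ℝ) (hp : ((n : ℝ) - 1) / p = (n : ℝ) / 2 - s) :
    ∃ C > (0 : ℝ),
      ∀ v : SchwartzMap (EuclideanSpace ℝ (Fin n)) ℝ,
        ∀ r : ℝ, 0 < r →
          r ^ ((n : ℝ) / 2 - s) * sphereLpNorm n p (fun x => v x) r
            ≤ C * homSobolevNorm n s (fun x => v x) := by
  obtain ⟨C, hC, hmain⟩ := lem5 n hn s hs1 hs2 p hp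
  have hppos : 0 < p := by
    have h2 : (2:ℝ) ≤ n := by exact_mod_cast hn
    by_contra hneg
    have := div_nonpos_of_nonneg_of_nonpos (by linarith : 0 ≤ (n:ℝ) - 1) (not_lt.1 hneg)
    linarith
  refine ⟨C ^ (1/p), by positivity, fun v r hr => ?_⟩
  set V : SchwartzMap (EE n) ℂ := v.postcompCLM Complex.ofRealCLM with hV
  have hVv : (V : EE n → ℂ) = fun x => (v x : ℂ) := by
    ext x; rfl
  set F : SchwartzMap (EE n) ℂ := 𝓕 V with hF
  have hFv : (F : EE n → ℂ) = 𝓕 (fun x : EE n => (v x : ℂ)) := by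
    rw [hF, SchwartzMap.fourier_coe, hVv]
  have hinv : ∀ x : EE n, (v x : ℂ) = ∫ ξ, ch x ξ * F ξ := by
    intro x
    have h1 : 𝓕⁻ F = V := FourierTransform.fourierInv_fourier_eq V
    have h2 : (𝓕⁻ F : SchwartzMap (EE n) ℂ) x = (v x : ℂ) := by rw [h1]; rfl
    rw [← h2, SchwartzMap.fourierInv_coe, Real.fourierInv_eq']
    congr 1
    ext ξ
    rw [smul_eq_mul, ch, real_inner_comm]
  set I := ∫ ξ : EE n, ‖ξ‖ ^ (2*s) * ‖F ξ‖^2 with hI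
  have hI0 : 0 ≤ I := integral_nonneg fun ξ => by positivity
  have hIint := schwartz_int n s (by linarith) F
  have hnorm : homSobolevNorm n s (fun x => v x) = √I := by
    unfold homSobolevNorm
    rw [hI, hFv]
  set α := (n:ℝ)/2 - s with hα
  have key : ∀ m > r ^ (-α) * √I, sphereLpNorm n p (fun x => v x) r ≤ C ^ (1/p) * m := by
    intro m hm
    have hm0 : 0 < m := lt_of_le_of_lt (by positivity) hm
    set h : EE n → ℂ := fun ξ => ((m⁻¹ * (r^n)⁻¹ : ℝ) : ℂ) * F (r⁻¹ • ξ) with hh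
    have hFc := F.continuous
    have hhc : Continuous h := by fun_prop
    have hhi : Integrable h := (F.integrable.comp_smul (inv_ne_zero hr.ne')).const_mul _
    have hW : ∀ x : EE n, WW h x = ((m⁻¹ * v (r • x) : ℝ) : ℂ) := by
      intro x
      have h1 := Measure.integral_comp_inv_smul_of_nonneg (volume : Measure (EE n)) (fun ξ => ch (r • x) ξ * F ξ) hr.le
      rw [← hinv] at h1
      unfold WW
      calc _ = ∫ ξ, ((m⁻¹ * (r^n)⁻¹ : ℝ) : ℂ) * (ch (r • x) (r⁻¹ • ξ) * F (r⁻¹ • ξ)) := by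
            congr 1
            ext ξ
            have : ch (r • x) (r⁻¹ • ξ) = ch x ξ := by
              unfold ch
              rw [inner_smul_left, inner_smul_right]
              simp [hr.ne']
            rw [this, hh]
            ring
        _ = _ := by
            rw [integral_const_mul, h1]
            simp only [finrank_euclideanSpace, Fintype.card_fin, Complex.real_smul]
            push_cast
            have : (r:ℂ) ≠ 0 := by exact_mod_cast hr.ne'
            field_simp
    have hH : ∫⁻ ξ, ENNReal.ofReal (‖ξ‖ ^ (2*s) * ‖h ξ‖^2) ≤ 1 := by
      have e0 : ∀ ξ : EE n, ‖ξ‖ ^ (2*s) * ‖h ξ‖^2 = (m⁻¹ * (r^n)⁻¹)^2 * r^(2*s) * (‖r⁻¹ • ξ‖ ^ (2*s) * ‖F (r⁻¹ • ξ)‖^2) := by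
        intro ξ
        rw [hh]
        simp only [norm_mul, Complex.norm_real, norm_smul, norm_inv]
        rw [Real.mul_rpow (by positivity) (by positivity), Real.norm_of_nonneg hr.le, Real.inv_rpow hr.le,
          Real.norm_of_nonneg hm0.le, Real.norm_of_nonneg (by positivity : 0 ≤ r^n)]
        have : 0 < r ^ (2*s) := by positivity
        field_simp
      simp_rw [e0]
      rw [← ofReal_integral_eq_lintegral_ofReal ((hIint.comp_smul (inv_ne_zero hr.ne')).const_mul _) (Filter.Eventually.of_forall fun ξ => by positivity),
        integral_const_mul, Measure.integral_comp_inv_smul_of_nonneg (volume : Measure (EE n)) (fun ξ => ‖ξ‖ ^ (2*s) * ‖F ξ‖^2) hr.le,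
        ← ENNReal.ofReal_one]
      refine ENNReal.ofReal_le_ofReal ?_
      simp only [finrank_euclideanSpace, Fintype.card_fin, smul_eq_mul]
      rw [← hI]
      have h1 : (r ^ (-α) * √I)^2 ≤ m^2 := by gcongr
      rw [mul_pow, Real.sq_sqrt hI0] at h1
      have h2 : (r ^ (-α))^2 = r^(2*s) * (r^n)⁻¹ := by
        rw [← Real.rpow_natCast, ← Real.rpow_mul hr.le, ← Real.rpow_natCast, ← Real.rpow_neg hr.le, ← Real.rpow_add hr, hα]
        congr 1
        push_cast
        ring
      rw [h2] at h1
      calc _ = (m^2)⁻¹ * (r^(2*s) * (r^n)⁻¹ * I) := by field_simp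
        _ ≤ (m^2)⁻¹ * m^2 := by gcongr
        _ = 1 := by field_simp
    have hfin := hmain h hhc.measurable hhi hH
    have hvc := v.continuous
    have hc1 : Continuous (fun y : SS n => |v (r • (y : EE n))| ^ p) := by
      refine Continuous.rpow_const (by fun_prop) fun _ => Or.inr hppos.le
    have e1 : ∀ y : SS n, ‖WW h y‖ ^ p = (m⁻¹)^p * |v (r • (y : EE n))| ^ p := by
      intro y
      rw [hW, Complex.norm_real, Real.norm_eq_abs, abs_mul, abs_of_pos (inv_pos.2 hm0), Real.mul_rpow (by positivity) (by positivity)]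
    simp_rw [e1] at hfin
    rw [← ofReal_integral_eq_lintegral_ofReal ((intS hc1).const_mul _) (Filter.Eventually.of_forall fun y => by positivity),
      ENNReal.ofReal_le_ofReal_iff hC.le, integral_const_mul] at hfin
    unfold sphereLpNorm
    set J := ∫ y : SS n, |v (r • (y : EE n))| ^ p ∂(sg n) with hJ
    have hJ0 : 0 ≤ J := integral_nonneg fun y => by positivity
    have h3 : J ≤ C * m ^ p := by
      rw [Real.inv_rpow hm0.le, inv_mul_le_iff₀ (by positivity)] at hfin
      linarith
    calc J ^ (1/p) ≤ (C * m^p) ^ (1/p) := by gcongr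
      _ = _ := by
        rw [Real.mul_rpow hC.le (by positivity), ← Real.rpow_mul hm0.le, mul_one_div_cancel hppos.ne', Real.rpow_one]
  have hCp : 0 < C ^ (1/p) := by positivity
  have key2 : sphereLpNorm n p (fun x => v x) r ≤ C ^ (1/p) * (r ^ (-α) * √I) := by
    rw [← div_le_iff₀' hCp]
    refine le_of_forall_gt_imp_ge_of_dense fun m hm => ?_
    rw [div_le_iff₀' hCp]
    exact key m hm
  rw [hnorm]
  calc _ ≤ r ^ α * (C ^ (1/p) * (r ^ (-α) * √I)) := by gcongr
    _ = _ := by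
      rw [Real.rpow_neg hr.le]
      have : 0 < r ^ α := by positivity
      field_simp
end
end
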